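/- Let {(μ_{k_j}, u_{k_j})}_{j≥0} be a subsequence of the discrete first eigenpairs of the adaptive algorithm for which ‖u_{k_j} − u_∞‖_{W^{1,p}(Ω)} → 0, and let M_{k_j} ⊆ T_{k_j} be the marked element sets. Then the largest marked local error indicator vanishes in the limit: lim_{j→∞} max_{T ∈ M_{k_j}} η_{k_j}(μ_{k_j}, u_{k_j}; T) = 0. -/

import Mathlib

open MeasureTheory Filter Topology Metric
open scoped RealInnerProductSpace ENNReal NNReal Classical

noncomputable section

namespace PLaplacianAFEM

/-- Euclidean space ℝ^d. -/
abbrev E (d : ℕ) := EuclideanSpace ℝ (Fin d)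

/-- ∫_Ω |u|^p dx. -/
def lpPow (d : ℕ) (Ω : Set (E d)) (p : ℝ) (u : E d → ℝ) : ℝ :=
  ∫ x in Ω, |u x| ^ p

/-- ∫_Ω |∇u|^p dx. -/
def gradPow (d : ℕ) (Ω : Set (E d)) (p : ℝ) (u : E d → ℝ) : ℝ :=
  ∫ x in Ω, ‖gradient u x‖ ^ p

/-- Rayleigh quotient J(u) = (∫_Ω |∇u|^p)/(∫_Ω |u|^p). -/
def rayleigh (d : ℕ) (Ω : Set (E d)) (p : ℝ) (u : E d → ℝ) : ℝ :=
  gradPow d Ω p u / lpPow d Ω p u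

/-- The W^{1,p}(Ω)-norm. -/
def w1pNorm (d : ℕ) (Ω : Set (E d)) (p : ℝ) (u : E d → ℝ) : ℝ :=
  (lpPow d Ω p u + gradPow d Ω p u) ^ (1 / p)

/-- W^{1,p}(Ω)-distance. -/
def w1pDist (d : ℕ) (Ω : Set (E d)) (p : ℝ) (u v : E d → ℝ) : ℝ :=
  w1pNorm d Ω p (u - v)

/-- A smooth test function compactly supported in Ω. -/
def IsTestFun (d : ℕ) (Ω : Set (E d)) (v : E d → ℝ) : Prop :=
  ContDiff ℝ (⊤ : ℕ∞) v ∧ HasCompactSupport v ∧ tsupport v ⊆ Ω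

/-- W_0^{1,p}(Ω), the closure of C_c^∞(Ω) in the W^{1,p}(Ω)-norm. -/
def sobolevW0 (d : ℕ) (Ω : Set (E d)) (p : ℝ) : Set (E d → ℝ) :=
  {u | ∀ ε > 0, ∃ φ, IsTestFun d Ω φ ∧ w1pDist d Ω p u φ < ε}

/-- A (closed) d-simplex in ℝ^d. -/
def IsSimplex (d : ℕ) (K : Set (E d)) : Prop :=
  ∃ v : Fin (d + 1) → E d, AffineIndependent ℝ v ∧ K = convexHull ℝ (Set.range v)

/-- A conforming simplicial triangulation of the closure of Ω. -/
def IsTriangulation (d : ℕ) (Ω : Set (E d)) (T : Finset (Set (E d))) : Prop :=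
  (∀ K ∈ T, IsSimplex d K) ∧
  (⋃ K ∈ T, K) = closure Ω ∧
  (∀ K ∈ T, ∀ K' ∈ T, K ≠ K' → interior K ∩ interior K' = ∅)

/-- The conforming P1 finite element space on the mesh T : continuous functions,
vanishing outside Ω (in particular on ∂Ω), affine on each element. -/
def femSpace (d : ℕ) (Ω : Set (E d)) (T : Finset (Set (E d))) : Set (E d → ℝ) :=
  {u | ContinuousOn u (closure Ω) ∧ (∀ x ∉ Ω, u x = 0) ∧
    ∀ K ∈ T, ∃ (L : E d →L[ℝ] ℝ) (c : ℝ), ∀ x ∈ K, u x = L x + c}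

/-- Element size h_T := |T|^{1/d}. -/
def meshSize (d : ℕ) (K : Set (E d)) : ℝ := (volume K).toReal ^ ((1 : ℝ) / d)

/-- Face size h_F := |F|^{1/(d-1)} (with |F| the (d-1)-dimensional Hausdorff measure). -/
def faceSize (d : ℕ) (F : Set (E d)) : ℝ :=
  (μH[(d : ℝ) - 1] F).toReal ^ ((1 : ℝ) / ((d : ℝ) - 1))

/-- The patch D_K of all elements touching K. -/
def patch (d : ℕ) (T : Finset (Set (E d))) (K : Set (E d)) : Set (E d) :=
  ⋃ K' ∈ T, ⋃ (_ : (K ∩ K').Nonempty), K'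

/-- The nonlinear flux of a (constant) gradient g : |g|^{p-2} g. -/
def flux (d : ℕ) (p : ℝ) (g : E d) : E d := ‖g‖ ^ (p - 2) • g

/-- A (d-1)-dimensional simplex (possible face of elements). -/
def IsFaceSimplex (d : ℕ) (F : Set (E d)) : Prop :=
  ∃ w : Fin d → E d, AffineIndependent ℝ w ∧ F = convexHull ℝ (Set.range w)

/-- An interior face: a (d-1)-simplex not contained in ∂Ω. -/
def IsInteriorFace (d : ℕ) (Ω : Set (E d)) (F : Set (E d)) : Prop :=
  IsFaceSimplex d F ∧ ¬ F ⊆ frontier Ω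

/-- The local error indicator η_k^q(μ, u; K) (with q = p/(p-1)); `g K'` is the
(constant) gradient of the piecewise linear u on the element K', so that the jump of
the flux across the face K ∩ K' is flux(g K) - flux(g K') (it is normal to the face
for continuous piecewise linear u). -/
def etaQLoc (d : ℕ) (Ω : Set (E d)) (p : ℝ) (T : Finset (Set (E d)))
    (g : Set (E d) → E d) (μ : ℝ) (u : E d → ℝ) (K : Set (E d)) : ℝ :=
  meshSize d K ^ (p / (p - 1)) *
      (∫ x in K, |μ * |u x| ^ (p - 2) * u x| ^ (p / (p - 1)))
  + ∑ K' ∈ T, if K' ≠ K ∧ IsInteriorFace d Ω (K ∩ K') then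
      faceSize d (K ∩ K') *
        ∫ x in K ∩ K', ‖flux d p (g K) - flux d p (g K')‖ ^ (p / (p - 1)) ∂ μH[(d : ℝ) - 1]
    else 0

/-- The error estimator η_k(μ,u;M) := (Σ_{K ∈ M} η_k^q(μ,u;K))^{1/q}. -/
def etaOn (d : ℕ) (Ω : Set (E d)) (p : ℝ) (T : Finset (Set (E d)))
    (g : Set (E d) → E d) (μ : ℝ) (u : E d → ℝ) (M : Finset (Set (E d))) : ℝ :=
  (∑ K ∈ M, etaQLoc d Ω p T g μ u K) ^ ((p - 1) / p)

/-- The residual ⟨R(μ,u), v⟩. -/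
def residual (d : ℕ) (Ω : Set (E d)) (p : ℝ) (μ : ℝ) (u v : E d → ℝ) : ℝ :=
  (∫ x in Ω, ‖gradient u x‖ ^ (p - 2) * ⟪gradient u x, gradient v x⟫)
    - μ * ∫ x in Ω, |u x| ^ (p - 2) * u x * v x

/-- The first Dirichlet eigenvalue λ₁ = inf_{v ∈ W_0^{1,p}(Ω)\{0}} J(v). -/
def lambda1 (d : ℕ) (Ω : Set (E d)) (p : ℝ) : ℝ :=
  sInf (rayleigh d Ω p '' {v | v ∈ sobolevW0 d Ω p ∧ lpPow d Ω p v ≠ 0})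

/-- The set E of all L^p-normalized eigenfunctions of the Dirichlet p-Laplacian. -/
def ESet (d : ℕ) (Ω : Set (E d)) (p : ℝ) : Set (E d → ℝ) :=
  {u | u ∈ sobolevW0 d Ω p ∧ lpPow d Ω p u = 1 ∧ ∃ lam : ℝ,
    ∀ v ∈ sobolevW0 d Ω p,
      (∫ x in Ω, ‖gradient u x‖ ^ (p - 2) * ⟪gradient u x, gradient v x⟫)
        = lam * ∫ x in Ω, |u x| ^ (p - 2) * u x * v x}

/-- The set E_{λ₁} of L^p-normalized first eigenfunctions. -/
def firstEigenSet (d : ℕ) (Ω : Set (E d)) (p : ℝ) : Set (E d → ℝ) :=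
  {u | u ∈ sobolevW0 d Ω p ∧ lpPow d Ω p u = 1 ∧
    ∀ v ∈ sobolevW0 d Ω p,
      (∫ x in Ω, ‖gradient u x‖ ^ (p - 2) * ⟪gradient u x, gradient v x⟫)
        = lambda1 d Ω p * ∫ x in Ω, |u x| ^ (p - 2) * u x * v x}

/-- W^{2,∞}(Ω)-norm of a smooth function. -/
def w2inftyNorm (d : ℕ) (Ω : Set (E d)) (v : E d → ℝ) : ℝ :=
  sSup ((fun x => |v x| + ‖fderiv ℝ v x‖ + ‖fderiv ℝ (fderiv ℝ v) x‖) '' Ω)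

/-- The data produced by the adaptive finite element algorithm (AFEM):
nested, uniformly γ-shape-regular conforming triangulations T k obtained by marking
(each marked set containing an element of maximal local error indicator) and bisection,
discrete first eigenpairs (μ k, u k) with nonnegative, L^p-normalized minimizers of the
Rayleigh quotient over the P1 space, and g k K the constant gradient of u k on K. -/
structure AFEM (d : ℕ) (Ω : Set (E d)) (p : ℝ) (γ : ℝ) where
  T : ℕ → Finset (Set (E d))
  g : ℕ → Set (E d) → E d
  u : ℕ → E d → ℝ
  μ : ℕ → ℝ
  M : ℕ → Finset (Set (E d))
  tri : ∀ k, IsTriangulation d Ω (T k)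
  shape : ∀ k, ∀ K ∈ T k, ∃ x r, 0 < r ∧ ball x r ⊆ K ∧ diam K ≤ γ * r
  nested : ∀ k, femSpace d Ω (T k) ⊆ femSpace d Ω (T (k + 1))
  mem : ∀ k, u k ∈ femSpace d Ω (T k)
  sob : ∀ k, u k ∈ sobolevW0 d Ω p
  gradComp : ∀ k, ∀ K ∈ T k, ∃ c : ℝ, ∀ x ∈ K, u k x = ⟪g k K, x⟫ + c
  normed : ∀ k, lpPow d Ω p (u k) = 1
  nonneg : ∀ k, ∀ x, 0 ≤ u k x
  minim : ∀ k, ∀ v ∈ femSpace d Ω (T k), v ≠ 0 →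
    rayleigh d Ω p (u k) ≤ rayleigh d Ω p v
  eig : ∀ k, μ k = rayleigh d Ω p (u k)
  marked : ∀ k, M k ⊆ T k
  markedNe : ∀ k, (M k).Nonempty
  markMax : ∀ k, ∃ K ∈ M k, ∀ K' ∈ T k,
    etaQLoc d Ω p (T k) (g k) (μ k) (u k) K' ≤ etaQLoc d Ω p (T k) (g k) (μ k) (u k) K
  refined : ∀ k, ∀ K ∈ M k, K ∉ T (k + 1)

variable {d : ℕ} {Ω : Set (E d)} {p γ : ℝ}

/-- The limit space V_∞ := closure of ∪_k V_k in the W^{1,p}-norm. -/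
def Vinf (A : AFEM d Ω p γ) : Set (E d → ℝ) :=
  {v | ∀ ε > 0, ∃ k, ∃ w ∈ femSpace d Ω (A.T k), w1pDist d Ω p v w < ε}

/-- T_k^+ : the elements of T k never refined afterwards. -/
def Tplus (A : AFEM d Ω p γ) (k : ℕ) : Finset (Set (E d)) :=
  (A.T k).filter fun K => ∀ m, k ≤ m → K ∈ A.T m

/-- Ω_k^0 : the union of the patches of the elements of T k refined at some later stage. -/
def Omega0 (A : AFEM d Ω p γ) (k : ℕ) : Set (E d) :=
  ⋃ K ∈ {K | K ∈ A.T k ∧ ∃ m, k ≤ m ∧ K ∉ A.T m}, patch d (A.T k) K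

/-- ‖h_j‖_{L^∞(S)} : sup of the mesh sizes of elements of T j meeting S. -/
def meshSizeSupOn (A : AFEM d Ω p γ) (j : ℕ) (S : Set (E d)) : ℝ :=
  sSup (meshSize d '' {K | K ∈ A.T j ∧ (K ∩ S).Nonempty})


/-! ### Piecewise affine functions -/

lemma IsSimplex.convex {K : Set (E d)} (hK : IsSimplex d K) : Convex ℝ K := by
  obtain ⟨v, -, rfl⟩ := hK
  exact convex_convexHull ℝ _

lemma IsSimplex.isCompact {K : Set (E d)} (hK : IsSimplex d K) : IsCompact K := by
  obtain ⟨v, -, rfl⟩ := hK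
  exact (Set.finite_range v).isCompact_convexHull ℝ

lemma IsSimplex.nonempty {K : Set (E d)} (hK : IsSimplex d K) : K.Nonempty := by
  obtain ⟨v, -, rfl⟩ := hK
  exact (Set.range_nonempty v).convexHull

lemma continuous_of_mem_femSpace (hΩ : IsOpen Ω) {T : Finset (Set (E d))} {v : E d → ℝ}
    (hv : v ∈ femSpace d Ω T) : Continuous v := by
  rw [continuous_iff_continuousAt]
  intro x
  have h1 : ContinuousWithinAt v (closure Ω) x := by
    by_cases hx : x ∈ closure Ω
    · exact hv.1 x hx
    · have : 𝓝[closure Ω] x = ⊥ := by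
        rwa [← notMem_closure_iff_nhdsWithin_eq_bot, closure_closure]
      simp [ContinuousWithinAt, this]
  have h2 : ContinuousWithinAt v (closure Ω)ᶜ x := by
    by_cases hx : x ∈ Ω
    · have hmem : closure Ω ∈ 𝓝 x := mem_of_superset (hΩ.mem_nhds hx) subset_closure
      have : 𝓝[(closure Ω)ᶜ] x = ⊥ := by
        rw [nhdsWithin, ← disjoint_iff]
        exact disjoint_principal_right.2 (by simpa using hmem)
      simp [ContinuousWithinAt, this]
    · refine (continuous_const (y := (0 : ℝ))).continuousWithinAt.congr (fun y hy => ?_) (hv.2.1 x hx)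
      exact hv.2.1 y fun h => hy (subset_closure h)
  have := h1.union h2
  rwa [Set.union_compl_self, continuousWithinAt_univ] at this

lemma hasCompactSupport_of_mem_femSpace (hΩ : Bornology.IsBounded Ω) {T : Finset (Set (E d))}
    {v : E d → ℝ} (hv : v ∈ femSpace d Ω T) : HasCompactSupport v :=
  HasCompactSupport.intro hΩ.isCompact_closure fun x hx =>
    hv.2.1 x fun h => hx (subset_closure h)

lemma add_mem_femSpace {T : Finset (Set (E d))} {v w : E d → ℝ}
    (hv : v ∈ femSpace d Ω T) (hw : w ∈ femSpace d Ω T) : v + w ∈ femSpace d Ω T := by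
  refine ⟨hv.1.add hw.1, fun x hx => by simp [hv.2.1 x hx, hw.2.1 x hx], fun K hK => ?_⟩
  obtain ⟨L, c, h⟩ := hv.2.2 K hK
  obtain ⟨L', c', h'⟩ := hw.2.2 K hK
  exact ⟨L + L', c + c', fun x hx => by simp [h x hx, h' x hx]; ring⟩

lemma smul_mem_femSpace {T : Finset (Set (E d))} {v : E d → ℝ} (a : ℝ)
    (hv : v ∈ femSpace d Ω T) : a • v ∈ femSpace d Ω T := by
  refine ⟨hv.1.const_smul a, fun x hx => by simp [hv.2.1 x hx], fun K hK => ?_⟩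
  obtain ⟨L, c, h⟩ := hv.2.2 K hK
  exact ⟨a • L, a * c, fun x hx => by simp [h x hx]; ring⟩

lemma hasGradientAt_of_eq_affine {K : Set (E d)} {v : E d → ℝ} {g : E d} {c : ℝ}
    (h : ∀ x ∈ K, v x = ⟪g, x⟫ + c) {x : E d} (hx : x ∈ interior K) : HasGradientAt v g x := by
  have h1 : HasGradientAt (fun y => ⟪g, y⟫ + c) g x := by
    rw [hasGradientAt_iff_hasFDerivAt]
    exact ((InnerProductSpace.toDual ℝ (E d) g).hasFDerivAt).add_const c
  refine h1.congr_of_eventuallyEq ?_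
  filter_upwards [mem_interior_iff_mem_nhds.1 hx] with y hy using h y hy

lemma exists_gradients_of_mem_femSpace {T : Finset (Set (E d))} {v : E d → ℝ}
    (hv : v ∈ femSpace d Ω T) :
    ∃ g : Set (E d) → E d, ∀ K ∈ T, ∃ c : ℝ, ∀ x ∈ K, v x = ⟪g K, x⟫ + c := by
  choose! L c h using hv.2.2
  refine ⟨fun K => (InnerProductSpace.toDual ℝ (E d)).symm (L K), fun K hK => ⟨c K, fun x hx => ?_⟩⟩
  rw [h K hK x hx, InnerProductSpace.toDual_symm_apply]

lemma ae_notMem_frontier {T : Finset (Set (E d))} (hT : IsTriangulation d Ω T) :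
    ∀ᵐ x : E d, ∀ K ∈ T, x ∉ frontier K := by
  refine (ae_ball_iff T.countable_toSet).2 fun K hK => ?_
  exact measure_eq_zero_iff_ae_notMem.1 ((hT.1 K hK).convex.addHaar_frontier volume)

lemma ae_mem_interior {T : Finset (Set (E d))} (hΩ : IsOpen Ω) (hT : IsTriangulation d Ω T) :
    ∀ᵐ x ∂volume.restrict Ω, ∃ K ∈ T, x ∈ interior K := by
  rw [ae_restrict_iff' hΩ.measurableSet]
  filter_upwards [ae_notMem_frontier hT] with x hx hxΩ
  have : x ∈ ⋃ K ∈ T, K := hT.2.1 ▸ subset_closure hxΩ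
  obtain ⟨K, hK, hxK⟩ := by simpa using this
  refine ⟨K, hK, ?_⟩
  have h := hx K hK
  rw [frontier, (hT.1 K hK).isCompact.isClosed.closure_eq] at h
  by_contra h'
  exact h ⟨hxK, h'⟩

lemma ae_differentiableAt {T : Finset (Set (E d))} (hΩ : IsOpen Ω) (hT : IsTriangulation d Ω T)
    {v : E d → ℝ} (hv : v ∈ femSpace d Ω T) :
    ∀ᵐ x ∂volume.restrict Ω, DifferentiableAt ℝ v x := by
  obtain ⟨g, hg⟩ := exists_gradients_of_mem_femSpace hv
  filter_upwards [ae_mem_interior hΩ hT] with x ⟨K, hK, hx⟩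
  obtain ⟨c, hc⟩ := hg K hK
  exact (hasGradientAt_of_eq_affine hc hx).differentiableAt

lemma exists_ae_norm_gradient_le {T : Finset (Set (E d))} (hΩ : IsOpen Ω)
    (hT : IsTriangulation d Ω T) {v : E d → ℝ} (hv : v ∈ femSpace d Ω T) :
    ∃ C, 0 ≤ C ∧ ∀ᵐ x ∂volume.restrict Ω, ‖gradient v x‖ ≤ C := by
  obtain ⟨g, hg⟩ := exists_gradients_of_mem_femSpace hv
  refine ⟨∑ K ∈ T, ‖g K‖, Finset.sum_nonneg fun K _ => norm_nonneg _, ?_⟩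
  filter_upwards [ae_mem_interior hΩ hT] with x ⟨K, hK, hx⟩
  obtain ⟨c, hc⟩ := hg K hK
  rw [(hasGradientAt_of_eq_affine hc hx).gradient]
  exact Finset.single_le_sum (f := fun K => ‖g K‖) (fun K _ => norm_nonneg _) hK

lemma measurable_gradient (v : E d → ℝ) : Measurable (gradient v) :=
  (InnerProductSpace.toDual ℝ (E d)).symm.continuous.measurable.comp (measurable_fderiv ℝ v)

lemma integrable_norm_gradient_rpow {T : Finset (Set (E d))} (hΩ : IsOpen Ω)
    (hΩb : Bornology.IsBounded Ω) (hT : IsTriangulation d Ω T) (hp : 0 ≤ p) {v : E d → ℝ}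
    (hv : v ∈ femSpace d Ω T) : IntegrableOn (fun x => ‖gradient v x‖ ^ p) Ω := by
  obtain ⟨C, hC, h⟩ := exists_ae_norm_gradient_le hΩ hT hv
  have : IsFiniteMeasure (volume.restrict Ω) :=
    ⟨by simpa using hΩb.measure_lt_top⟩
  refine Integrable.of_bound
    ((measurable_gradient v).norm.pow_const p).aestronglyMeasurable (C ^ p) ?_
  filter_upwards [h] with x hx
  rw [Real.norm_of_nonneg (by positivity)]
  gcongr

lemma lpPow_nonneg (u : E d → ℝ) : 0 ≤ lpPow d Ω p u :=
  integral_nonneg fun x => by positivity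

lemma gradPow_nonneg (u : E d → ℝ) : 0 ≤ gradPow d Ω p u :=
  integral_nonneg fun x => by positivity

lemma rayleigh_nonneg (u : E d → ℝ) : 0 ≤ rayleigh d Ω p u :=
  div_nonneg (gradPow_nonneg u) (lpPow_nonneg u)

/-! ### The discrete eigenpairs -/

namespace AFEM

variable (A : AFEM d Ω p γ)

lemma femSpace_mono {k l : ℕ} (h : k ≤ l) : femSpace d Ω (A.T k) ⊆ femSpace d Ω (A.T l) :=
  monotone_nat_of_le_succ (f := fun k => femSpace d Ω (A.T k)) A.nested h

lemma gradPow_u (k : ℕ) : gradPow d Ω p (A.u k) = A.μ k := by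
  rw [A.eig, rayleigh, A.normed, div_one]

lemma μ_nonneg (k : ℕ) : 0 ≤ A.μ k := A.eig k ▸ rayleigh_nonneg _

lemma u_ne_zero (hp : 0 < p) (k : ℕ) : A.u k ≠ 0 := by
  intro h
  have := A.normed k
  simp [h, lpPow, Real.zero_rpow hp.ne'] at this

lemma antitone_μ (hp : 0 < p) : Antitone A.μ := by
  refine antitone_nat_of_succ_le fun k => ?_
  rw [A.eig, A.eig k]
  exact A.minim _ _ (A.nested k (A.mem k)) (A.u_ne_zero hp k)

lemma μ_mul_lpPow_le (hp : 0 < p) {k : ℕ} {v : E d → ℝ} (hv : v ∈ femSpace d Ω (A.T k)) :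
    A.μ k * lpPow d Ω p v ≤ gradPow d Ω p v := by
  rcases (lpPow_nonneg (Ω := Ω) (p := p) v).eq_or_lt with h | h
  · simpa [← h] using gradPow_nonneg v
  · have hv0 : v ≠ 0 := by
      rintro rfl
      simp [lpPow, Real.zero_rpow hp.ne'] at h
    rw [A.eig, ← le_div_iff₀ h]
    exact A.minim k v hv hv0

end AFEM

/-! ### Uniform convexity and convergence of the gradients -/

section UniformConvexity

variable {V : Type*} [NormedAddCommGroup V] [NormedSpace ℝ V]

lemma half_norm_rpow_add_le (hp : 1 ≤ p) (a b : V) :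
    ‖(1 / 2 : ℝ) • (a + b)‖ ^ p ≤ (1 / 2) * ‖a‖ ^ p + (1 / 2) * ‖b‖ ^ p := by
  have h1 : ‖(1 / 2 : ℝ) • (a + b)‖ ≤ (1 / 2) * ‖a‖ + (1 / 2) * ‖b‖ := by
    rw [norm_smul, Real.norm_of_nonneg (by norm_num)]
    linarith [norm_add_le a b]
  have h2 := (convexOn_rpow hp).2 (norm_nonneg a : ‖a‖ ∈ Set.Ici (0 : ℝ))
    (norm_nonneg b : ‖b‖ ∈ Set.Ici (0 : ℝ))
    (by norm_num : (0 : ℝ) ≤ 1 / 2) (by norm_num : (0 : ℝ) ≤ 1 / 2) (by norm_num)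
  simp only [smul_eq_mul] at h2
  exact (Real.rpow_le_rpow (norm_nonneg _) h1 (by linarith)).trans h2

lemma half_norm_rpow_add_lt [StrictConvexSpace ℝ V] (hp : 1 < p) {a b : V} (hab : a ≠ b) :
    ‖(1 / 2 : ℝ) • (a + b)‖ ^ p < (1 / 2) * ‖a‖ ^ p + (1 / 2) * ‖b‖ ^ p := by
  by_cases h : ‖a‖ = ‖b‖
  · have h1 := (norm_midpoint_lt_iff h).2 hab
    have h2 := Real.rpow_lt_rpow (norm_nonneg _) h1 (by linarith : 0 < p)
    rw [← h]
    linarith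
  · have h1 : ‖(1 / 2 : ℝ) • (a + b)‖ ≤ (1 / 2) * ‖a‖ + (1 / 2) * ‖b‖ := by
      rw [norm_smul, Real.norm_of_nonneg (by norm_num)]
      linarith [norm_add_le a b]
    have h2 := (strictConvexOn_rpow hp).2 (norm_nonneg a : ‖a‖ ∈ Set.Ici (0 : ℝ))
      (norm_nonneg b : ‖b‖ ∈ Set.Ici (0 : ℝ)) h
      (by norm_num : (0 : ℝ) < 1 / 2) (by norm_num : (0 : ℝ) < 1 / 2) (by norm_num)
    simp only [smul_eq_mul] at h2
    exact (Real.rpow_le_rpow (norm_nonneg _) h1 (by linarith)).trans_lt h2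

/-- A pointwise form of the uniform convexity of `L^p`. -/
lemma exists_norm_sub_rpow_le [StrictConvexSpace ℝ V] [FiniteDimensional ℝ V] (hp : 1 < p)
    {ε : ℝ} (hε : 0 < ε) :
    ∃ C, 0 ≤ C ∧ ∀ a b : V, ‖a - b‖ ^ p ≤ ε * (‖a‖ ^ p + ‖b‖ ^ p) +
      C * ((1 / 2) * ‖a‖ ^ p + (1 / 2) * ‖b‖ ^ p - ‖(1 / 2 : ℝ) • (a + b)‖ ^ p) := by
  have hp0 : 0 < p := by linarith
  have cn : ∀ f : V × V → V, Continuous f → Continuous fun z => ‖f z‖ ^ p := fun f hf =>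
    hf.norm.rpow_const fun _ => Or.inr hp0.le
  set S : Set (V × V) := {z | ‖z.1‖ ^ p + ‖z.2‖ ^ p = 1 ∧ ε ≤ ‖z.1 - z.2‖ ^ p} with hS
  have hSc : IsCompact S := by
    refine (isCompact_closedBall (0 : V × V) 1).of_isClosed_subset ?_ ?_
    · exact (isClosed_eq ((cn _ continuous_fst).add (cn _ continuous_snd))
        continuous_const).inter
        (isClosed_le continuous_const (cn _ (continuous_fst.sub continuous_snd)))
    · rintro ⟨a, b⟩ ⟨h, -⟩
      have ha : ‖a‖ ^ p ≤ 1 := by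
        have : 0 ≤ ‖b‖ ^ p := by positivity
        simp only at h; linarith
      have hb : ‖b‖ ^ p ≤ 1 := by
        have : 0 ≤ ‖a‖ ^ p := by positivity
        simp only at h; linarith
      have key : ∀ c : V, ‖c‖ ^ p ≤ 1 → ‖c‖ ≤ 1 := fun c hc => by
        by_contra! h'
        exact absurd hc (Real.one_lt_rpow h' hp0).not_ge
      simpa [Prod.norm_def] using ⟨key a ha, key b hb⟩
  set D : V × V → ℝ := fun z =>
    (1 / 2) * ‖z.1‖ ^ p + (1 / 2) * ‖z.2‖ ^ p - ‖(1 / 2 : ℝ) • (z.1 + z.2)‖ ^ p with hD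
  have hDc : Continuous D :=
    (((cn _ continuous_fst).const_mul _).add ((cn _ continuous_snd).const_mul _)).sub
      (cn _ ((continuous_fst.add continuous_snd).const_smul _))
  have hD0 : ∀ z ∈ S, 0 < D z := by
    rintro ⟨a, b⟩ ⟨-, h⟩
    have hab : a ≠ b := by
      rintro rfl
      simp only [sub_self, norm_zero, Real.zero_rpow hp0.ne'] at h
      linarith
    exact sub_pos.2 (half_norm_rpow_add_lt hp hab)
  obtain ⟨C, hC⟩ := (hSc.image_of_continuousOn
    (((cn _ (continuous_fst.sub continuous_snd)).continuousOn).div hDc.continuousOn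
      fun z hz => (hD0 z hz).ne')).bddAbove
  refine ⟨max C 0, le_max_right _ _, fun a b => ?_⟩
  have hDn : 0 ≤ D (a, b) := sub_nonneg.2 (half_norm_rpow_add_le hp.le a b)
  set s := ‖a‖ ^ p + ‖b‖ ^ p with hs
  have hs0 : 0 ≤ s := by positivity
  by_cases hc : ‖a - b‖ ^ p ≤ ε * s
  · have : 0 ≤ max C 0 * D (a, b) := mul_nonneg (le_max_right _ _) hDn
    simp only [hD] at this
    linarith
  push Not at hc
  have hs1 : 0 < s := by
    refine hs0.lt_of_ne fun h => ?_
    have ha : ‖a‖ ^ p = 0 := by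
      have : 0 ≤ ‖b‖ ^ p := by positivity
      have : 0 ≤ ‖a‖ ^ p := by positivity
      linarith
    have hb : ‖b‖ ^ p = 0 := by linarith
    rw [Real.rpow_eq_zero (norm_nonneg _) hp0.ne', norm_eq_zero] at ha hb
    rw [← h, ha, hb] at hc
    simp [Real.zero_rpow hp0.ne'] at hc
  set t := s ^ (-(1 / p)) with ht
  have ht0 : 0 < t := by positivity
  have htp : t ^ p = s⁻¹ := by
    rw [ht, ← Real.rpow_mul hs0, ← Real.rpow_neg_one]
    congr 1
    field_simp
  have scale : ∀ c : V, ‖t • c‖ ^ p = s⁻¹ * ‖c‖ ^ p := fun c => by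
    rw [norm_smul, Real.mul_rpow (norm_nonneg _) (norm_nonneg _), Real.norm_of_nonneg ht0.le, htp]
  have hmem : (t • a, t • b) ∈ S := by
    refine ⟨?_, ?_⟩
    · simp only [scale]
      rw [← mul_add, ← hs, inv_mul_cancel₀ hs1.ne']
    · simp only [← smul_sub, scale]
      rw [le_inv_mul_iff₀ hs1]
      linarith
  have h1 : ‖t • a - t • b‖ ^ p / D (t • a, t • b) ≤ C := hC ⟨_, hmem, rfl⟩
  have hDs : D (t • a, t • b) = s⁻¹ * D (a, b) := by
    simp only [hD]
    rw [← smul_add, smul_comm, scale, scale, scale]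
    ring
  rw [div_le_iff₀ (hD0 _ hmem), hDs, ← smul_sub, scale, mul_left_comm,
    mul_le_mul_iff_right₀ (by positivity)] at h1
  have h2 : C * D (a, b) ≤ max C 0 * D (a, b) := by gcongr; exact le_max_left _ _
  have h3 : 0 ≤ ε * s := by positivity
  simp only [hD] at h1 h2
  linarith

end UniformConvexity

lemma integrableOn_abs_rpow {v : E d → ℝ} (hp : 0 < p) (hv : Continuous v)
    (hc : HasCompactSupport v) : Integrable fun x => |v x| ^ p := by
  refine (hv.abs.rpow_const fun _ => Or.inr hp.le).integrable_of_hasCompactSupport ?_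
  exact hc.comp_left (g := fun y => |y| ^ p) (by simp [Real.zero_rpow hp.ne'])

lemma lpPow_rpow_eq (hp : 1 < p) {v : E d → ℝ} (hv : Continuous v) (hc : HasCompactSupport v) :
    lpPow d Ω p v ^ (1 / p) =
      (eLpNorm v (ENNReal.ofReal p) (volume.restrict Ω)).toReal := by
  have hp0 : 0 < p := by linarith
  have hm : MemLp v (ENNReal.ofReal p) (volume.restrict Ω) :=
    (hv.memLp_of_hasCompactSupport hc).restrict Ω
  rw [hm.eLpNorm_eq_integral_rpow_norm (by simpa using hp0) (by simp),
    ENNReal.toReal_ofReal (by positivity), ENNReal.toReal_ofReal hp0.le, lpPow, one_div]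
  simp

lemma lpPow_add_rpow_le (hp : 1 < p) {v w : E d → ℝ} (hv : Continuous v)
    (hvc : HasCompactSupport v) (hw : Continuous w) (hwc : HasCompactSupport w) :
    lpPow d Ω p (v + w) ^ (1 / p) ≤ lpPow d Ω p v ^ (1 / p) + lpPow d Ω p w ^ (1 / p) := by
  have hmv : MemLp v (ENNReal.ofReal p) (volume.restrict Ω) :=
    (hv.memLp_of_hasCompactSupport hvc).restrict Ω
  have hmw : MemLp w (ENNReal.ofReal p) (volume.restrict Ω) :=
    (hw.memLp_of_hasCompactSupport hwc).restrict Ω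
  rw [lpPow_rpow_eq hp hv hvc, lpPow_rpow_eq hp hw hwc,
    lpPow_rpow_eq hp (hv.add hw) (hvc.add hwc),
    ← ENNReal.toReal_add hmv.2.ne hmw.2.ne]
  exact ENNReal.toReal_mono (ENNReal.add_ne_top.2 ⟨hmv.2.ne, hmw.2.ne⟩)
    (eLpNorm_add_le hmv.1 hmw.1 (by simpa using ENNReal.ofReal_le_ofReal hp.le))

lemma lpPow_smul {a : ℝ} (ha : 0 ≤ a) (v : E d → ℝ) :
    lpPow d Ω p (a • v) = a ^ p * lpPow d Ω p v := by
  rw [lpPow, lpPow, ← integral_const_mul]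
  congr 1 with x
  rw [Pi.smul_apply, smul_eq_mul, abs_mul, abs_of_nonneg ha, Real.mul_rpow ha (abs_nonneg _)]

namespace AFEM

variable (A : AFEM d Ω p γ)

lemma continuous_u (hΩ : IsOpen Ω) (k : ℕ) : Continuous (A.u k) :=
  continuous_of_mem_femSpace hΩ (A.mem k)

lemma hasCompactSupport_u (hΩb : Bornology.IsBounded Ω) (k : ℕ) : HasCompactSupport (A.u k) :=
  hasCompactSupport_of_mem_femSpace hΩb (A.mem k)

/-- Convergence of the discrete eigenfunctions in `L^p` forces convergence of their gradients. -/
lemma exists_gradient_sub_lt (hΩ : IsOpen Ω) (hΩb : Bornology.IsBounded Ω) (hp : 1 < p)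
    {ε : ℝ} (hε : 0 < ε) :
    ∃ η > 0, ∃ N, ∀ k ≥ N, ∀ l ≥ N, lpPow d Ω p (A.u k - A.u l) < η →
      ∫ x in Ω, ‖gradient (A.u k) x - gradient (A.u l) x‖ ^ p < ε := by
  have hp0 : 0 < p := by linarith
  have hanti := A.antitone_μ hp0
  have hbdd : BddBelow (Set.range A.μ) := ⟨0, by rintro _ ⟨k, rfl⟩; exact A.μ_nonneg k⟩
  set m := ⨅ k, A.μ k with hm
  have hm0 : 0 ≤ m := le_ciInf A.μ_nonneg
  have hμ0 : 0 ≤ A.μ 0 := A.μ_nonneg 0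
  have hmμ : ∀ k, m ≤ A.μ k := fun k => ciInf_le hbdd k
  obtain ⟨C, hC0, hC⟩ := exists_norm_sub_rpow_le (V := E d) hp
    (show 0 < ε / (4 * (A.μ 0 + 1)) by positivity)
  set θ := min 1 (ε / (4 * (C + 1) * (A.μ 0 + 1))) with hθ
  have hθ0 : 0 < θ := by positivity
  have hθ1 : θ ≤ 1 := min_le_left _ _
  obtain ⟨N, hN⟩ := ((tendsto_atTop_ciInf hanti hbdd).eventually
    (gt_mem_nhds (show m < m + θ by linarith))).exists
  refine ⟨(θ / p) ^ p, by positivity, N, ?_⟩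
  intro k hk l hl hkl
  set a := gradient (A.u k) with ha
  set b := gradient (A.u l) with hb
  set n := max k l with hn
  set v : E d → ℝ := (1 / 2 : ℝ) • (A.u k + A.u l) with hv
  have hkn : A.u k ∈ femSpace d Ω (A.T n) := A.femSpace_mono (le_max_left _ _) (A.mem k)
  have hln : A.u l ∈ femSpace d Ω (A.T n) := A.femSpace_mono (le_max_right _ _) (A.mem l)
  have hvn : v ∈ femSpace d Ω (A.T n) := smul_mem_femSpace _ (add_mem_femSpace hkn hln)
  have hdn : A.u k - A.u l ∈ femSpace d Ω (A.T n) := by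
    simpa [sub_eq_add_neg] using add_mem_femSpace hkn (smul_mem_femSpace (-1) hln)
  have hwn : (1 / 2 : ℝ) • (A.u k - A.u l) ∈ femSpace d Ω (A.T n) := smul_mem_femSpace _ hdn
  -- gradients of the combinations
  have hgv : ∀ᵐ x ∂volume.restrict Ω, gradient v x = (1 / 2 : ℝ) • (a x + b x) := by
    filter_upwards [ae_differentiableAt hΩ (A.tri n) hkn, ae_differentiableAt hΩ (A.tri n) hln]
      with x h1 h2
    simp only [gradient, hv, ha, hb]
    rw [fderiv_const_smul (h1.add h2), fderiv_add h1 h2]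
    simp
  have hgd : ∀ᵐ x ∂volume.restrict Ω, gradient (A.u k - A.u l) x = a x - b x := by
    filter_upwards [ae_differentiableAt hΩ (A.tri n) hkn, ae_differentiableAt hΩ (A.tri n) hln]
      with x h1 h2
    simp only [gradient, ha, hb]
    rw [fderiv_sub h1 h2]
    simp
  have ik := integrable_norm_gradient_rpow hΩ hΩb (A.tri n) hp0.le hkn
  have il := integrable_norm_gradient_rpow hΩ hΩb (A.tri n) hp0.le hln
  have iv : IntegrableOn (fun x => ‖(1 / 2 : ℝ) • (a x + b x)‖ ^ p) Ω := by
    refine (integrable_norm_gradient_rpow hΩ hΩb (A.tri n) hp0.le hvn).congr ?_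
    filter_upwards [hgv] with x hx using by rw [hx]
  have id : IntegrableOn (fun x => ‖a x - b x‖ ^ p) Ω := by
    refine (integrable_norm_gradient_rpow hΩ hΩb (A.tri n) hp0.le hdn).congr ?_
    filter_upwards [hgd] with x hx using by rw [hx]
  have ev : ∫ x in Ω, ‖(1 / 2 : ℝ) • (a x + b x)‖ ^ p = gradPow d Ω p v := by
    refine integral_congr_ae ?_
    filter_upwards [hgv] with x hx using by rw [hx]
  have ek : ∫ x in Ω, ‖a x‖ ^ p = A.μ k := A.gradPow_u k
  have el : ∫ x in Ω, ‖b x‖ ^ p = A.μ l := A.gradPow_u l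
  have main : ∫ x in Ω, ‖a x - b x‖ ^ p ≤ ε / (4 * (A.μ 0 + 1)) * (A.μ k + A.μ l) +
      C * ((1 / 2) * A.μ k + (1 / 2) * A.μ l - gradPow d Ω p v) := by
    have i0 : IntegrableOn (fun x => ‖a x‖ ^ p + ‖b x‖ ^ p) Ω := ik.add il
    have i1 : IntegrableOn (fun x => (1 / 2) * ‖a x‖ ^ p + (1 / 2) * ‖b x‖ ^ p) Ω :=
      (ik.const_mul (1 / 2)).add (il.const_mul (1 / 2))
    have i2 : IntegrableOn (fun x => (1 / 2) * ‖a x‖ ^ p + (1 / 2) * ‖b x‖ ^ p -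
      ‖(1 / 2 : ℝ) • (a x + b x)‖ ^ p) Ω := i1.sub iv
    calc _ ≤ ∫ x in Ω, (ε / (4 * (A.μ 0 + 1)) * (‖a x‖ ^ p + ‖b x‖ ^ p) +
          C * ((1 / 2) * ‖a x‖ ^ p + (1 / 2) * ‖b x‖ ^ p - ‖(1 / 2 : ℝ) • (a x + b x)‖ ^ p)) :=
          integral_mono id ((i0.const_mul _).add (i2.const_mul C))
            fun x => hC (a x) (b x)
      _ = _ := by
          rw [integral_add (i0.const_mul _) (i2.const_mul C), integral_const_mul,
            integral_const_mul, integral_add ik il, integral_sub i1 iv,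
            integral_add (ik.const_mul (1 / 2)) (il.const_mul (1 / 2)), integral_const_mul,
            integral_const_mul, ek, el, ev]
  -- the midpoint has almost unit norm
  have hnorm : 1 - θ ≤ lpPow d Ω p v := by
    have h1 := lpPow_add_rpow_le (Ω := Ω) hp (continuous_of_mem_femSpace hΩ hvn)
      (hasCompactSupport_of_mem_femSpace hΩb hvn) (continuous_of_mem_femSpace hΩ hwn)
      (hasCompactSupport_of_mem_femSpace hΩb hwn)
    have h2 : v + (1 / 2 : ℝ) • (A.u k - A.u l) = A.u k := by
      ext x
      simp [hv]
      ring
    rw [h2, A.normed, Real.one_rpow, lpPow_smul (by norm_num) (A.u k - A.u l)] at h1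
    have h3 : ((1 / 2 : ℝ) ^ p * lpPow d Ω p (A.u k - A.u l)) ^ (1 / p) ≤ θ / p := by
      have h4 : (1 / 2 : ℝ) ^ p ≤ 1 := Real.rpow_le_one (by norm_num) (by norm_num) hp0.le
      have h5 := lpPow_nonneg (Ω := Ω) (p := p) (A.u k - A.u l)
      calc _ ≤ ((θ / p) ^ p) ^ (1 / p) := by
            refine Real.rpow_le_rpow (by positivity) ?_ (by positivity)
            nlinarith
        _ = θ / p := by
            rw [← Real.rpow_mul (by positivity), mul_one_div_cancel hp0.ne', Real.rpow_one]
    have h4 : 1 - θ / p ≤ lpPow d Ω p v ^ (1 / p) := by linarith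
    have h5 : θ / p ≤ 1 := by
      rw [div_le_one hp0]
      linarith
    calc 1 - θ = 1 + p * (-(θ / p)) := by field_simp; ring
      _ ≤ (1 + -(θ / p)) ^ p := one_add_mul_self_le_rpow_one_add (by linarith) hp.le
      _ ≤ (lpPow d Ω p v ^ (1 / p)) ^ p :=
        Real.rpow_le_rpow (by linarith) (by linarith) hp0.le
      _ = lpPow d Ω p v := by
        rw [← Real.rpow_mul (lpPow_nonneg v), one_div_mul_cancel hp0.ne', Real.rpow_one]
  have hgrad : m * (1 - θ) ≤ gradPow d Ω p v :=
    calc m * (1 - θ) ≤ A.μ n * lpPow d Ω p v :=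
          mul_le_mul (hmμ n) hnorm (by linarith) (A.μ_nonneg n)
      _ ≤ _ := A.μ_mul_lpPow_le hp0 hvn
  have hμk : A.μ k ≤ m + θ := (hanti hk).trans hN.le
  have hμl : A.μ l ≤ m + θ := (hanti hl).trans hN.le
  have hbr : (1 / 2) * A.μ k + (1 / 2) * A.μ l - gradPow d Ω p v ≤ θ * (A.μ 0 + 1) := by
    have := mul_le_mul_of_nonneg_right (hmμ 0) hθ0.le
    linarith
  have hs1 : ε / (4 * (A.μ 0 + 1)) * (A.μ k + A.μ l) ≤ ε / 2 := by
    calc _ ≤ ε / (4 * (A.μ 0 + 1)) * (2 * (A.μ 0 + 1)) := by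
          gcongr
          linarith [hanti (Nat.zero_le k), hanti (Nat.zero_le l)]
      _ = _ := by field_simp; norm_num
  have hs2 : C * (θ * (A.μ 0 + 1)) ≤ ε / 4 := by
    calc _ ≤ (C + 1) * (ε / (4 * (C + 1) * (A.μ 0 + 1)) * (A.μ 0 + 1)) := by
          gcongr
          · linarith
          · exact min_le_right _ _
      _ = _ := by field_simp
  have := mul_le_mul_of_nonneg_left hbr hC0
  linarith

end AFEM

/-! ### Translation estimate -/

lemma ae_eq_zero_of_mem_of_notMem {K : Set (E d)} {v : E d → ℝ} {g : E d} {c : ℝ}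
    (h : ∀ x ∈ K, v x = ⟪g, x⟫ + c) (hv : ∀ x ∉ Ω, v x = 0) :
    ∀ᵐ y : E d, y ∈ K → y ∉ Ω → g = 0 := by
  by_cases hg : g = 0
  · simp [hg]
  by_cases hne : ∃ y₀ : E d, ⟪g, y₀⟫ + c = 0
  · obtain ⟨y₀, hy₀⟩ := hne
    have hker : LinearMap.ker (innerSL ℝ g).toLinearMap ≠ ⊤ := by
      intro htop
      have : g ∈ LinearMap.ker (innerSL ℝ g).toLinearMap := htop ▸ Submodule.mem_top
      exact hg (by simpa using this)
    have hnull := Measure.addHaar_affineSubspace volume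
      (AffineSubspace.mk' y₀ (LinearMap.ker (innerSL ℝ g).toLinearMap)) (by
        intro htop
        have := congrArg AffineSubspace.direction htop
        rw [AffineSubspace.direction_mk', AffineSubspace.direction_top] at this
        exact hker this)
    filter_upwards [measure_eq_zero_iff_ae_notMem.1 hnull] with y hy hyK hyΩ
    refine absurd ?_ hy
    have h1 := (h y hyK).symm.trans (hv y hyΩ)
    simp only [SetLike.mem_coe, AffineSubspace.mem_mk', vsub_eq_sub, LinearMap.mem_ker,
      ContinuousLinearMap.coe_coe, innerSL_apply_apply, inner_sub_right]
    linarith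
  · push Not at hne
    exact ae_of_all _ fun y hyK hyΩ => absurd ((h y hyK).symm.trans (hv y hyΩ)) (hne y)

lemma ae_sum_indicator_eq {T : Finset (Set (E d))} (hT : IsTriangulation d Ω T)
    {v : E d → ℝ} (hv : ∀ x ∉ Ω, v x = 0) {g : Set (E d) → E d}
    (hg : ∀ K ∈ T, ∃ c : ℝ, ∀ x ∈ K, v x = ⟪g K, x⟫ + c) {φ : E d → ℝ} (hφ : φ 0 = 0) :
    ∀ᵐ y : E d, ∑ K ∈ T, K.indicator (fun _ => φ (g K)) y =
      Ω.indicator (fun x => φ (gradient v x)) y := by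
  have h0 : ∀ᵐ y : E d, ∀ K ∈ T, y ∈ K → y ∉ Ω → g K = 0 := by
    refine (ae_ball_iff T.countable_toSet).2 fun K hK => ?_
    obtain ⟨c, hc⟩ := hg K hK
    exact ae_eq_zero_of_mem_of_notMem hc hv
  filter_upwards [h0, ae_notMem_frontier hT] with y hy0 hyf
  by_cases hy : y ∈ Ω
  · have hint : ∀ K ∈ T, y ∈ K → y ∈ interior K := fun K hK hyK => by
      have h := hyf K hK
      rw [frontier, (hT.1 K hK).isCompact.isClosed.closure_eq] at h
      by_contra h'
      exact h ⟨hyK, h'⟩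
    have : y ∈ ⋃ K ∈ T, K := hT.2.1 ▸ subset_closure hy
    obtain ⟨K, hK, hyK⟩ := by simpa using this
    obtain ⟨c, hc⟩ := hg K hK
    rw [Set.indicator_of_mem hy, (hasGradientAt_of_eq_affine hc (hint K hK hyK)).gradient,
      Finset.sum_eq_single_of_mem K hK, Set.indicator_of_mem hyK]
    intro K' hK' hne
    refine Set.indicator_of_notMem (fun hyK' => ?_) _
    have : y ∈ interior K' ∩ interior K := ⟨hint K' hK' hyK', hint K hK hyK⟩
    rw [hT.2.2 K' hK' K hK hne] at this
    exact this
  · rw [Set.indicator_of_notMem hy]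
    refine Finset.sum_eq_zero fun K hK => ?_
    by_cases hyK : y ∈ K
    · rw [Set.indicator_of_mem hyK, hy0 K hK hyK hy, hφ]
    · exact Set.indicator_of_notMem hyK _

/-- A continuous piecewise affine function has right derivatives along every line, bounded by
the norms of the gradients of the adjacent pieces. -/
lemma exists_hasDerivWithinAt_line {T : Finset (Set (E d))}
    (hT : ∀ K ∈ T, Convex ℝ K ∧ IsClosed K) {v : E d → ℝ} (hv : Continuous v)
    (hv0 : ∀ x ∉ ⋃ K ∈ T, K, v x = 0) {g : Set (E d) → E d}
    (hg : ∀ K ∈ T, ∃ c : ℝ, ∀ x ∈ K, v x = ⟪g K, x⟫ + c) (x h : E d) (t : ℝ) :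
    ∃ a, HasDerivWithinAt (fun s : ℝ => v (x + s • h)) a (Set.Ioi t) t ∧
      |a| ≤ ‖h‖ * ∑ K ∈ T, K.indicator (fun _ => ‖g K‖) (x + t • h) := by
  have hline : Continuous fun s : ℝ => x + s • h := by fun_prop
  have hsum : 0 ≤ ∑ K ∈ T, K.indicator (fun _ => ‖g K‖) (x + t • h) :=
    Finset.sum_nonneg fun K _ => Set.indicator_nonneg (fun _ _ => norm_nonneg _) _
  by_cases hc : ∃ K ∈ T, ∃ᶠ s in 𝓝[>] t, x + s • h ∈ K
  · obtain ⟨K, hK, hfr⟩ := hc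
    have hconv : Convex ℝ ((fun s : ℝ => x + s • h) ⁻¹' K) := by
      intro s hs s' hs' a b ha hb hab
      have := (hT K hK).1 hs hs' ha hb hab
      simp only [Set.mem_preimage, smul_eq_mul] at this ⊢
      convert this using 1
      rw [smul_add, smul_add, add_smul, mul_smul, mul_smul]
      have : x = a • x + b • x := by rw [← add_smul, hab, one_smul]
      nth_rw 1 [this]
      abel
    have htK : x + t • h ∈ K := by
      have hcl : IsClosed ((fun s : ℝ => x + s • h) ⁻¹' K) := (hT K hK).2.preimage hline
      exact hcl.mem_of_frequently_of_tendsto hfr (tendsto_id.mono_left nhdsWithin_le_nhds)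
    obtain ⟨s₀, hs₀K, hs₀⟩ := (hfr.and_eventually self_mem_nhdsWithin).exists
    obtain ⟨c, hcK⟩ := hg K hK
    refine ⟨⟪g K, h⟫, ?_, ?_⟩
    · have h1 : HasDerivWithinAt (fun s : ℝ => ⟪g K, x⟫ + s * ⟪g K, h⟫ + c) ⟪g K, h⟫
          (Set.Ioi t) t := by
        simpa using (((hasDerivWithinAt_id t (Set.Ioi t)).mul_const ⟪g K, h⟫).const_add
          ⟪g K, x⟫).add_const c
      refine h1.congr_of_eventuallyEq ?_ ?_
      · filter_upwards [Ioo_mem_nhdsGT hs₀] with s hs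
        have : x + s • h ∈ K := hconv.ordConnected.out htK hs₀K ⟨hs.1.le, hs.2.le⟩
        rw [hcK _ this, inner_add_right, inner_smul_right]
      · rw [hcK _ htK, inner_add_right, inner_smul_right]
    · calc |⟪g K, h⟫| ≤ ‖g K‖ * ‖h‖ := abs_real_inner_le_norm _ _
        _ = ‖h‖ * K.indicator (fun _ => ‖g K‖) (x + t • h) := by
            rw [Set.indicator_of_mem htK, mul_comm]
        _ ≤ _ := by
            gcongr
            exact Finset.single_le_sum (f := fun K => K.indicator (fun _ => ‖g K‖) (x + t • h))
              (fun K _ => Set.indicator_nonneg (fun _ _ => norm_nonneg _) _) hK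
  · push Not at hc
    have hev : ∀ᶠ s in 𝓝[>] t, v (x + s • h) = 0 := by
      have : ∀ᶠ s in 𝓝[>] t, ∀ K ∈ T, x + s • h ∉ K :=
        (Finset.eventually_all T).2 fun K hK => by simpa using hc K hK
      filter_upwards [this] with s hs
      exact hv0 _ (by simpa using hs)
    have ht : v (x + t • h) = 0 := by
      have h1 : Tendsto (fun s : ℝ => v (x + s • h)) (𝓝[>] t) (𝓝 (v (x + t • h))) :=
        ((hv.comp hline).tendsto t).mono_left nhdsWithin_le_nhds
      exact tendsto_nhds_unique (h1.congr' hev) tendsto_const_nhds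
    exact ⟨0, (hasDerivWithinAt_const t (Set.Ioi t) (0 : ℝ)).congr_of_eventuallyEq hev ht,
      by simpa using mul_nonneg (norm_nonneg h) hsum⟩

lemma abs_sub_le_integral {T : Finset (Set (E d))}
    (hT : ∀ K ∈ T, Convex ℝ K ∧ IsClosed K) {v : E d → ℝ} (hv : Continuous v)
    (hv0 : ∀ x ∉ ⋃ K ∈ T, K, v x = 0) {g : Set (E d) → E d}
    (hg : ∀ K ∈ T, ∃ c : ℝ, ∀ x ∈ K, v x = ⟪g K, x⟫ + c) (x h : E d) :
    |v (x + h) - v x| ≤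
      ∫ t in (0 : ℝ)..1, ‖h‖ * ∑ K ∈ T, K.indicator (fun _ => ‖g K‖) (x + t • h) := by
  choose a ha hle using exists_hasDerivWithinAt_line hT hv hv0 hg x h
  have hline : Continuous fun s : ℝ => x + s • h := by fun_prop
  have hint : IntegrableOn
      (fun t : ℝ => ‖h‖ * ∑ K ∈ T, K.indicator (fun _ => ‖g K‖) (x + t • h)) (Set.Icc 0 1) := by
    refine Integrable.const_mul (integrable_finsetSum _ fun K hK => ?_) _
    have : IntegrableOn (fun _ : ℝ => ‖g K‖) (Set.Icc 0 1) := integrableOn_const (by simp)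
    exact this.indicator ((hT K hK).2.preimage hline).measurableSet
  have h1 := intervalIntegral.sub_le_integral_of_hasDeriv_right_of_le zero_le_one
    (hv.comp hline).continuousOn (fun t _ => ha t) hint
    fun t _ => (le_abs_self _).trans (hle t)
  have h2 := intervalIntegral.sub_le_integral_of_hasDeriv_right_of_le zero_le_one
    (hv.comp hline).neg.continuousOn (fun t _ => (ha t).neg) hint
    fun t _ => (neg_le_abs _).trans (hle t)
  simp only [Function.comp_apply, Pi.neg_apply, one_smul, zero_smul, add_zero] at h1 h2
  rw [abs_le]
  constructor <;> linarith

lemma lintegral_translate_le (hp : 1 ≤ p) {T : Finset (Set (E d))}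
    (hT : ∀ K ∈ T, Convex ℝ K ∧ IsClosed K) {v : E d → ℝ} (hv : Continuous v)
    (hv0 : ∀ x ∉ ⋃ K ∈ T, K, v x = 0) {g : Set (E d) → E d}
    (hg : ∀ K ∈ T, ∃ c : ℝ, ∀ x ∈ K, v x = ⟪g K, x⟫ + c) (h : E d) :
    ∫⁻ x, ENNReal.ofReal (|v (x + h) - v x| ^ p) ≤ ENNReal.ofReal (‖h‖ ^ p) *
      ∫⁻ y, ENNReal.ofReal ((∑ K ∈ T, K.indicator (fun _ => ‖g K‖) y) ^ p) := by
  set G : E d → ℝ := fun y => ∑ K ∈ T, K.indicator (fun _ => ‖g K‖) y with hG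
  have hGm : Measurable G := Finset.measurable_fun_sum _ fun K hK =>
    measurable_const.indicator (hT K hK).2.measurableSet
  have hG0 : ∀ y, 0 ≤ G y := fun y =>
    Finset.sum_nonneg fun K _ => Set.indicator_nonneg (fun _ _ => norm_nonneg _) _
  have hGb : ∀ y, G y ≤ ∑ K ∈ T, ‖g K‖ := fun y =>
    Finset.sum_le_sum fun K _ => Set.indicator_le_self' (fun _ _ => norm_nonneg _) y
  have hline : ∀ x : E d, Continuous fun s : ℝ => x + s • h := fun x => by fun_prop
  set ν : Measure ℝ := volume.restrict (Set.Ioc 0 1) with hν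
  have hνp : IsProbabilityMeasure ν := ⟨by simp [hν]⟩
  have hp0 : 0 ≤ p := by linarith
  have key : ∀ x, ENNReal.ofReal (|v (x + h) - v x| ^ p) ≤
      ENNReal.ofReal (‖h‖ ^ p) * ∫⁻ t, ENNReal.ofReal (G (x + t • h) ^ p) ∂ν := by
    intro x
    have hm : Measurable fun t : ℝ => G (x + t • h) := hGm.comp (hline x).measurable
    have i1 : Integrable (fun t : ℝ => G (x + t • h)) ν :=
      Integrable.of_bound hm.aestronglyMeasurable (∑ K ∈ T, ‖g K‖) (ae_of_all _ fun t => by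
        rw [Real.norm_of_nonneg (hG0 _)]; exact hGb _)
    have i2 : Integrable (fun t : ℝ => G (x + t • h) ^ p) ν :=
      Integrable.of_bound (hm.pow_const p).aestronglyMeasurable ((∑ K ∈ T, ‖g K‖) ^ p)
        (ae_of_all _ fun t => by
          rw [Real.norm_of_nonneg (Real.rpow_nonneg (hG0 _) _)]
          exact Real.rpow_le_rpow (hG0 _) (hGb _) hp0)
    have h1 := abs_sub_le_integral hT hv hv0 hg x h
    rw [intervalIntegral.integral_of_le zero_le_one, integral_const_mul] at h1
    have h2 := (convexOn_rpow hp).map_average_le (μ := ν) (f := fun t => G (x + t • h))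
      (continuousOn_id.rpow_const fun _ _ => Or.inr hp0) isClosed_Ici
      (ae_of_all _ fun t => hG0 _) i1 i2
    rw [average_eq_integral, average_eq_integral] at h2
    rw [← ofReal_integral_eq_lintegral_ofReal i2
      (ae_of_all _ fun t => Real.rpow_nonneg (hG0 _) _), ← ENNReal.ofReal_mul (by positivity)]
    refine ENNReal.ofReal_le_ofReal ?_
    calc |v (x + h) - v x| ^ p ≤ (‖h‖ * ∫ t, G (x + t • h) ∂ν) ^ p :=
          Real.rpow_le_rpow (abs_nonneg _) h1 hp0
      _ = ‖h‖ ^ p * (∫ t, G (x + t • h) ∂ν) ^ p :=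
          Real.mul_rpow (norm_nonneg _) (integral_nonneg fun t => hG0 _)
      _ ≤ _ := by gcongr
  calc _ ≤ ∫⁻ x, ENNReal.ofReal (‖h‖ ^ p) * ∫⁻ t, ENNReal.ofReal (G (x + t • h) ^ p) ∂ν :=
        lintegral_mono key
    _ = ENNReal.ofReal (‖h‖ ^ p) * ∫⁻ x, ∫⁻ t, ENNReal.ofReal (G (x + t • h) ^ p) ∂ν :=
        lintegral_const_mul' _ _ ENNReal.ofReal_ne_top
    _ = ENNReal.ofReal (‖h‖ ^ p) * ∫⁻ t, (∫⁻ x, ENNReal.ofReal (G (x + t • h) ^ p)) ∂ν := by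
        rw [lintegral_lintegral_swap]
        have : Measurable fun z : E d × ℝ => z.1 + z.2 • h := by fun_prop
        exact ((hGm.comp this).pow_const p).ennreal_ofReal.aemeasurable
    _ = _ := by
        congr 1
        have : ∀ t : ℝ, ∫⁻ x, ENNReal.ofReal (G (x + t • h) ^ p) =
            ∫⁻ y, ENNReal.ofReal (G y ^ p) := fun t =>
          lintegral_add_right_eq_self (fun y => ENNReal.ofReal (G y ^ p)) (t • h)
        simp only [this, lintegral_const, measure_univ, mul_one]
        rfl

namespace AFEM

variable (A : AFEM d Ω p γ)

lemma lintegral_u_translate_le (hΩ : IsOpen Ω) (hΩb : Bornology.IsBounded Ω) (hp : 1 < p)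
    (k : ℕ) (h : E d) :
    ∫⁻ x, ENNReal.ofReal (|A.u k (x + h) - A.u k x| ^ p) ≤ ENNReal.ofReal (‖h‖ ^ p * A.μ k) := by
  have hp0 : 0 < p := by linarith
  have hT := A.tri k
  have hu := (A.mem k).2.1
  refine (lintegral_translate_le hp.le
    (fun K hK => ⟨(hT.1 K hK).convex, (hT.1 K hK).isCompact.isClosed⟩) (A.continuous_u hΩ k)
    (fun x hx => hu x fun hxΩ => hx (hT.2.1 ▸ subset_closure hxΩ)) (A.gradComp k) h).trans ?_
  rw [ENNReal.ofReal_mul (by positivity)]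
  refine mul_le_mul_right (le_of_eq ?_) _
  rw [← A.gradPow_u k, gradPow, ofReal_integral_eq_lintegral_ofReal
    (integrable_norm_gradient_rpow hΩ hΩb hT hp0.le (A.mem k))
    (ae_of_all _ fun x => by positivity), ← lintegral_indicator hΩ.measurableSet]
  refine lintegral_congr_ae ?_
  filter_upwards [ae_sum_indicator_eq hT hu (A.gradComp k) (φ := fun z => ‖z‖) norm_zero]
    with y hy
  rw [hy]
  by_cases hyΩ : y ∈ Ω
  · simp [hyΩ]
  · simp [hyΩ, Real.zero_rpow hp0.ne']

end AFEM

/-! ### Compactness in `L^p` and equi-integrability of the gradients -/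

/-- Comparison of a function with its average over a nearby ball. -/
lemma ofReal_abs_sub_average_le (hp : 1 ≤ p) {v : E d → ℝ} (hv : Continuous v) {r : ℝ}
    (hr : 0 < r) {x y : E d} (hxy : dist x y < r) :
    ENNReal.ofReal (|v x - ⨍ z in ball y r, v z| ^ p) ≤ (volume (ball (0 : E d) r))⁻¹ *
      ∫⁻ h in ball (0 : E d) (2 * r), ENNReal.ofReal (|v (x + h) - v x| ^ p) := by
  have hp0 : 0 ≤ p := by linarith
  set ν : Measure (E d) := volume.restrict (ball y r) with hν
  have hfin : IsFiniteMeasure ν := ⟨by simpa [hν] using measure_ball_lt_top⟩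
  have hν0 : NeZero ν := ⟨by simpa [hν, Measure.restrict_eq_zero] using
    (measure_ball_pos volume y hr).ne'⟩
  have hint : ∀ f : E d → ℝ, Continuous f → Integrable f ν := fun f hf =>
    (hf.continuousOn.integrableOn_compact (isCompact_closedBall y r)).mono_set
      ball_subset_closedBall
  have hcf : Continuous fun z => |v x - v z| := (continuous_const.sub hv).abs
  have hcp : Continuous fun z => |v x - v z| ^ p := hcf.rpow_const fun _ => Or.inr hp0
  have hconst : ⨍ _z, v x ∂ν = v x := average_const _ _
  have h1 : |v x - ⨍ z, v z ∂ν| ≤ ⨍ z, |v x - v z| ∂ν := by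
    have e : v x - ⨍ z, v z ∂ν = ⨍ z, (v x - v z) ∂ν := by
      nth_rw 1 [← hconst]
      simp only [average_eq]
      rw [integral_sub (hint _ continuous_const) (hint _ hv), smul_sub]
    rw [e, average_eq, average_eq, smul_eq_mul, smul_eq_mul, abs_mul, abs_of_nonneg (by positivity)]
    gcongr
    exact abs_integral_le_integral_abs
  have h2 := (convexOn_rpow hp).map_average_le (μ := ν) (f := fun z => |v x - v z|)
    (continuousOn_id.rpow_const fun _ _ => Or.inr hp0) isClosed_Ici
    (ae_of_all _ fun t => Set.mem_Ici.2 (abs_nonneg _)) (hint _ hcf) (hint _ hcp)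
  have h3 : |v x - ⨍ z, v z ∂ν| ^ p ≤ ⨍ z, |v x - v z| ^ p ∂ν :=
    (Real.rpow_le_rpow (abs_nonneg _) h1 hp0).trans h2
  refine (ENNReal.ofReal_le_ofReal h3).trans ?_
  have hvol : volume (ball y r) = volume (ball (0 : E d) r) :=
    Measure.addHaar_ball_center volume y r
  rw [average_eq, smul_eq_mul, ENNReal.ofReal_mul (by positivity),
    ofReal_integral_eq_lintegral_ofReal (hint _ hcp) (ae_of_all _ fun z => by positivity)]
  gcongr ?_ * ?_
  · rw [Measure.real, ← ENNReal.toReal_inv, hν, Measure.restrict_apply_univ, hvol]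
    exact ENNReal.ofReal_toReal_le
  · calc ∫⁻ z in ball y r, ENNReal.ofReal (|v x - v z| ^ p)
        ≤ ∫⁻ z in ball x (2 * r), ENNReal.ofReal (|v x - v z| ^ p) := by
          refine lintegral_mono_set (ball_subset_ball' ?_)
          rw [dist_comm y x]
          linarith
      _ = ∫⁻ h in ball (0 : E d) (2 * r), ENNReal.ofReal (|v x - v (x + h)| ^ p) := by
          rw [← lintegral_indicator measurableSet_ball, ← lintegral_indicator measurableSet_ball,
            ← lintegral_add_left_eq_self _ x]
          congr 1 with h
          simp only [Set.indicator, mem_ball, dist_self_add_left, dist_zero_right]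
      _ ≤ _ := le_of_eq (by simp only [abs_sub_comm])

lemma abs_add_three_rpow_le (hp : 0 ≤ p) (a b c : ℝ) :
    |a + b + c| ^ p ≤ 3 ^ p * (|a| ^ p + |b| ^ p + |c| ^ p) := by
  set m := max |a| (max |b| |c|) with hm
  have hm0 : 0 ≤ m := (abs_nonneg a).trans (le_max_left _ _)
  have h1 : |a + b + c| ≤ 3 * m := by
    have := abs_add_three a b c
    have ha : |a| ≤ m := le_max_left _ _
    have hb : |b| ≤ m := (le_max_left _ _).trans (le_max_right _ _)
    have hc : |c| ≤ m := (le_max_right _ _).trans (le_max_right _ _)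
    linarith
  have ha : 0 ≤ |a| ^ p := by positivity
  have hb : 0 ≤ |b| ^ p := by positivity
  have hc : 0 ≤ |c| ^ p := by positivity
  calc |a + b + c| ^ p ≤ (3 * m) ^ p := Real.rpow_le_rpow (abs_nonneg _) h1 hp
    _ = 3 ^ p * m ^ p := Real.mul_rpow (by norm_num) hm0
    _ ≤ _ := by
      gcongr
      rcases max_choice |a| (max |b| |c|) with h | h
      · rw [hm, h]; linarith
      · rcases max_choice |b| |c| with h' | h' <;> rw [hm, h, h'] <;> linarith

lemma abs_average_le_of_lpPow_eq_one (hp : 1 < p) {v : E d → ℝ} (hv : Continuous v)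
    (hvc : HasCompactSupport v) (hv0 : ∀ x ∉ Ω, v x = 0) (h1 : lpPow d Ω p v = 1)
    (y : E d) {r : ℝ} :
    |⨍ z in ball y r, v z| ≤
      (volume.real (ball (0 : E d) r))⁻¹ * (1 + volume.real (ball (0 : E d) r)) := by
  have hp0 : 0 < p := by linarith
  have hvol : volume.real (ball y r) = volume.real (ball (0 : E d) r) := by
    simp [Measure.real, Measure.addHaar_ball_center volume y r]
  have hb : volume (ball y r) ≠ ∞ := measure_ball_lt_top.ne
  rw [setAverage_eq, smul_eq_mul, abs_mul, abs_of_nonneg (by positivity), hvol]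
  gcongr
  have hI := integrableOn_abs_rpow hp0 hv hvc
  have hle : ∀ z, |v z| ≤ |v z| ^ p + 1 := fun z => by
    rcases le_total |v z| 1 with h | h
    · have : 0 ≤ |v z| ^ p := by positivity
      linarith
    · have := Real.self_le_rpow_of_one_le h hp.le
      linarith
  have ht : ∫ z, |v z| ^ p = 1 := by
    rw [← h1, lpPow]
    refine (setIntegral_eq_integral_of_forall_compl_eq_zero fun x hx => ?_).symm
    simp [hv0 x hx, Real.zero_rpow hp0.ne']
  calc |∫ z in ball y r, v z| ≤ ∫ z in ball y r, |v z| := abs_integral_le_integral_abs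
    _ ≤ ∫ z in ball y r, (|v z| ^ p + 1) :=
        integral_mono (hv.integrable_of_hasCompactSupport hvc).abs.integrableOn
          (hI.integrableOn.add (integrableOn_const hb)) hle
    _ = (∫ z in ball y r, |v z| ^ p) + volume.real (ball y r) := by
        rw [integral_add hI.integrableOn (integrableOn_const hb)]
        simp
    _ ≤ 1 + volume.real (ball (0 : E d) r) := by
        rw [hvol, ← ht]
        refine add_le_add_left ?_ _
        exact setIntegral_le_integral hI (ae_of_all _ fun z => by positivity)

namespace AFEM

variable (A : AFEM d Ω p γ)

/-- Distance of two discrete eigenfunctions in terms of their averages over the balls of radius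
`r` centred at the points of an `r`-net. -/
lemma lpPow_sub_le_of_average (hΩ : IsOpen Ω) (hΩb : Bornology.IsBounded Ω) (hp : 1 < p)
    {r η : ℝ} (hr : 0 < r) (hη : 0 ≤ η) {t : Set (E d)} (ht : Ω ⊆ ⋃ y ∈ t, ball y r) {k l : ℕ}
    (hkl : ∀ y ∈ t, |(⨍ z in ball y r, A.u k z) - ⨍ z in ball y r, A.u l z| ≤ η) :
    lpPow d Ω p (A.u k - A.u l) ≤
      3 ^ p * (2 ^ d * (2 * r) ^ p * (A.μ 0 + A.μ 0) + η ^ p * volume.real Ω) := by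
  have hp0 : 0 < p := by linarith
  have hμ0 := A.μ_nonneg 0
  set b := volume (ball (0 : E d) r) with hb
  have hb0 : b ≠ 0 := (measure_ball_pos volume _ hr).ne'
  have hbt : b ≠ ∞ := measure_ball_lt_top.ne
  have hb2 : volume (ball (0 : E d) (2 * r)) = 2 ^ d * b := by
    rw [Measure.addHaar_ball_mul_of_pos volume 0 two_pos, finrank_euclideanSpace_fin,
      ENNReal.ofReal_pow zero_le_two, ENNReal.ofReal_ofNat]
  set W : ℕ → E d → ℝ≥0∞ := fun n x =>
    ∫⁻ h in ball (0 : E d) (2 * r), ENNReal.ofReal (|A.u n (x + h) - A.u n x| ^ p) with hW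
  have hmeas : ∀ n, Measurable fun z : E d × E d =>
      ENNReal.ofReal (|A.u n (z.1 + z.2) - A.u n z.1| ^ p) := fun n => by
    have hc := A.continuous_u hΩ n
    have : Continuous fun z : E d × E d => |A.u n (z.1 + z.2) - A.u n z.1| ^ p :=
      ((hc.comp (continuous_fst.add continuous_snd)).sub
        (hc.comp continuous_fst)).abs.rpow_const fun _ => Or.inr hp0.le
    exact this.measurable.ennreal_ofReal
  have hWm : ∀ n, Measurable (W n) := fun n => (hmeas n).lintegral_prod_right'
  have hWint : ∀ n, b⁻¹ * ∫⁻ x in Ω, W n x ≤ ENNReal.ofReal (2 ^ d * (2 * r) ^ p * A.μ 0) := by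
    intro n
    calc b⁻¹ * ∫⁻ x in Ω, W n x ≤ b⁻¹ * ∫⁻ x, W n x := by
          gcongr
          exact Measure.restrict_le_self
      _ = b⁻¹ * ∫⁻ h in ball (0 : E d) (2 * r),
            (∫⁻ x, ENNReal.ofReal (|A.u n (x + h) - A.u n x| ^ p)) := by
          rw [hW, lintegral_lintegral_swap (hmeas n).aemeasurable]
      _ ≤ b⁻¹ * ∫⁻ _ in ball (0 : E d) (2 * r), ENNReal.ofReal ((2 * r) ^ p * A.μ 0) := by
          refine mul_le_mul_right ?_ _
          refine setLIntegral_mono' measurableSet_ball fun h hh => ?_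
          refine (A.lintegral_u_translate_le hΩ hΩb hp n h).trans (ENNReal.ofReal_le_ofReal ?_)
          have : ‖h‖ ≤ 2 * r := (mem_ball_zero_iff.1 hh).le
          gcongr
          · exact A.μ_nonneg n
          · exact A.antitone_μ hp0 (Nat.zero_le n)
      _ = ENNReal.ofReal (2 ^ d * (2 * r) ^ p * A.μ 0) := by
          rw [setLIntegral_const, hb2, mul_assoc (2 ^ d),
            ENNReal.ofReal_mul (p := 2 ^ d) (by positivity),
            ENNReal.ofReal_pow zero_le_two, ENNReal.ofReal_ofNat]
          calc b⁻¹ * (ENNReal.ofReal ((2 * r) ^ p * A.μ 0) * (2 ^ d * b))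
              = b⁻¹ * b * (2 ^ d * ENNReal.ofReal ((2 * r) ^ p * A.μ 0)) := by ring
            _ = _ := by rw [ENNReal.inv_mul_cancel hb0 hbt, one_mul]
  have hpt : ∀ x ∈ Ω, ENNReal.ofReal (|(A.u k - A.u l) x| ^ p) ≤
      ENNReal.ofReal (3 ^ p) * (b⁻¹ * W k x + ENNReal.ofReal (η ^ p) + b⁻¹ * W l x) := by
    intro x hx
    obtain ⟨y, hy, hxy⟩ := by simpa using ht hx
    have hk := ofReal_abs_sub_average_le hp.le (A.continuous_u hΩ k) hr hxy
    have hl := ofReal_abs_sub_average_le hp.le (A.continuous_u hΩ l) hr hxy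
    set a := ⨍ z in ball y r, A.u k z
    set c := ⨍ z in ball y r, A.u l z
    have h3 := abs_add_three_rpow_le hp0.le (A.u k x - a) (a - c) (c - A.u l x)
    have e : A.u k x - a + (a - c) + (c - A.u l x) = (A.u k - A.u l) x := by
      simp
    rw [e, abs_sub_comm c] at h3
    refine (ENNReal.ofReal_le_ofReal h3).trans ?_
    rw [ENNReal.ofReal_mul (by positivity), ENNReal.ofReal_add (by positivity) (by positivity),
      ENNReal.ofReal_add (by positivity) (by positivity)]
    gcongr
    exact hkl y hy
  have hd : Continuous (A.u k - A.u l) := (A.continuous_u hΩ k).sub (A.continuous_u hΩ l)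
  have hdc : HasCompactSupport (A.u k - A.u l) :=
    (A.hasCompactSupport_u hΩb k).sub (A.hasCompactSupport_u hΩb l)
  rw [← ENNReal.ofReal_le_ofReal_iff (by positivity), lpPow,
    ofReal_integral_eq_lintegral_ofReal (integrableOn_abs_rpow hp0 hd hdc).integrableOn
      (ae_of_all _ fun x => by positivity)]
  calc _ ≤ ∫⁻ x in Ω, ENNReal.ofReal (3 ^ p) *
          (b⁻¹ * W k x + ENNReal.ofReal (η ^ p) + b⁻¹ * W l x) :=
        setLIntegral_mono' hΩ.measurableSet hpt
    _ = ENNReal.ofReal (3 ^ p) * (b⁻¹ * (∫⁻ x in Ω, W k x) +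
          ENNReal.ofReal (η ^ p) * volume Ω + b⁻¹ * ∫⁻ x in Ω, W l x) := by
        rw [lintegral_const_mul' _ _ ENNReal.ofReal_ne_top,
          lintegral_add_right _ ((hWm l).const_mul _), lintegral_add_right _ measurable_const,
          lintegral_const_mul _ (hWm k), lintegral_const_mul _ (hWm l), setLIntegral_const]
    _ ≤ ENNReal.ofReal (3 ^ p) * (ENNReal.ofReal (2 ^ d * (2 * r) ^ p * A.μ 0) +
          ENNReal.ofReal (η ^ p) * ENNReal.ofReal (volume.real Ω) +
          ENNReal.ofReal (2 ^ d * (2 * r) ^ p * A.μ 0)) := by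
        gcongr
        · exact hWint k
        · rw [Measure.real, ENNReal.ofReal_toReal hΩb.measure_lt_top.ne]
        · exact hWint l
    _ = _ := by
        rw [← ENNReal.ofReal_mul (by positivity), ← ENNReal.ofReal_add (by positivity)
          (by positivity), ← ENNReal.ofReal_add (by positivity) (by positivity),
          ← ENNReal.ofReal_mul (by positivity)]
        ring_nf

/-- The discrete eigenfunctions form a totally bounded family in `L^p`. -/
lemma exists_finite_lpPow_sub_lt (hΩ : IsOpen Ω) (hΩb : Bornology.IsBounded Ω) (hp : 1 < p)
    {η : ℝ} (hη : 0 < η) (N : ℕ) :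
    ∃ S : Set ℕ, S ⊆ Set.Ici N ∧ S.Finite ∧
      ∀ k ≥ N, ∃ i ∈ S, lpPow d Ω p (A.u k - A.u i) < η := by
  have hp0 : 0 < p := by linarith
  have hlim : Tendsto (fun s : ℝ => 3 ^ p * (2 ^ d * (2 * s) ^ p * (A.μ 0 + A.μ 0) +
      s ^ p * volume.real Ω)) (𝓝[>] 0) (𝓝 0) := by
    have hc : Continuous fun s : ℝ => 3 ^ p * (2 ^ d * (2 * s) ^ p * (A.μ 0 + A.μ 0) +
        s ^ p * volume.real Ω) := by
      have h1 : Continuous fun s : ℝ => (2 * s) ^ p :=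
        (continuous_const.mul continuous_id).rpow_const fun _ => Or.inr hp0.le
      have h2 : Continuous fun s : ℝ => s ^ p := continuous_id.rpow_const fun _ => Or.inr hp0.le
      fun_prop
    have h0 := (hc.tendsto 0).mono_left (nhdsWithin_le_nhds (s := Set.Ioi 0))
    simpa [Real.zero_rpow hp0.ne'] using h0
  obtain ⟨s, hs, hs0⟩ := ((hlim.eventually_lt_const hη).and self_mem_nhdsWithin).exists
  have hs0 : 0 < s := hs0
  obtain ⟨t, htf, ht⟩ := Metric.totallyBounded_iff.1
    (hΩb.isCompact_closure.totallyBounded.subset subset_closure) s hs0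
  have := htf.fintype
  set Φ : ℕ → (t → ℝ) := fun k y => ⨍ z in ball (y : E d) s, A.u k z with hΦ
  have hbd : Φ '' Set.Ici N ⊆ closedBall 0
      ((volume.real (ball (0 : E d) s))⁻¹ * (1 + volume.real (ball (0 : E d) s))) := by
    rintro _ ⟨k, -, rfl⟩
    rw [mem_closedBall_zero_iff, pi_norm_le_iff_of_nonneg (by positivity)]
    exact fun y => abs_average_le_of_lpPow_eq_one hp (A.continuous_u hΩ k)
      (A.hasCompactSupport_u hΩb k) (A.mem k).2.1 (A.normed k) y
  obtain ⟨S, hSN, hSf, hS⟩ := Set.exists_subset_image_finite_and.1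
    (Metric.finite_approx_of_totallyBounded
      ((isCompact_closedBall _ _).totallyBounded.subset hbd) s hs0)
  refine ⟨S, hSN, hSf, fun k hk => ?_⟩
  obtain ⟨i, hi, hki⟩ := by simpa using hS (Set.mem_image_of_mem Φ hk)
  refine ⟨i, hi, (A.lpPow_sub_le_of_average hΩ hΩb hp hs0 hs0.le ht fun y hy => ?_).trans_lt hs⟩
  have := (dist_pi_lt_iff hs0).1 hki ⟨y, hy⟩
  rw [Real.dist_eq] at this
  exact this.le

/-- The gradients of the discrete eigenfunctions are equi-integrable. -/
lemma exists_integral_closedBall_lt (hd : d ≠ 0) (hΩ : IsOpen Ω) (hΩb : Bornology.IsBounded Ω)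
    (hp : 1 < p) {ε : ℝ} (hε : 0 < ε) :
    ∃ δ > 0, ∃ N, ∀ k ≥ N, ∀ x,
      ∫ y in closedBall x δ ∩ Ω, ‖gradient (A.u k) y‖ ^ p < ε := by
  have hp0 : 0 < p := by linarith
  set c : ℝ := 2 ^ (p - 1) with hc
  have hc0 : 0 < c := by positivity
  obtain ⟨η, hη, N, hN⟩ := A.exists_gradient_sub_lt hΩ hΩb hp (ε := ε / (2 * c)) (by positivity)
  obtain ⟨S, hSN, hSf, hS⟩ := A.exists_finite_lpPow_sub_lt hΩ hΩb hp hη N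
  choose B hB0 hB using fun i => exists_ae_norm_gradient_le hΩ (A.tri i) (A.mem i)
  obtain ⟨Λ, hΛ⟩ := (hSf.image B).bddAbove
  have hlim : Tendsto (fun δ : ℝ => c * (|Λ| ^ p * (δ ^ d * volume.real (ball (0 : E d) 1))))
      (𝓝[>] 0) (𝓝 0) := by
    have h : Continuous fun δ : ℝ => c * (|Λ| ^ p * (δ ^ d * volume.real (ball (0 : E d) 1))) := by
      fun_prop
    have h0 := (h.tendsto 0).mono_left (nhdsWithin_le_nhds (s := Set.Ioi 0))
    simpa [hd] using h0
  obtain ⟨δ, hδ, hδ0⟩ := ((hlim.eventually_lt_const (half_pos hε)).and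
    self_mem_nhdsWithin).exists
  have hδ0 : 0 < δ := hδ0
  refine ⟨δ, hδ0, N, fun k hk x => ?_⟩
  obtain ⟨i, hi, hki⟩ := hS k hk
  have hgrad := hN k hk i (hSN hi) hki
  have hfin : IsFiniteMeasure (volume.restrict Ω) := ⟨by simpa using hΩb.measure_lt_top⟩
  have hint : IntegrableOn (fun y => ‖gradient (A.u k) y - gradient (A.u i) y‖ ^ p) Ω := by
    refine Integrable.of_bound (((measurable_gradient _).sub
      (measurable_gradient _)).norm.pow_const p).aestronglyMeasurable ((B k + B i) ^ p) ?_
    filter_upwards [hB k, hB i] with y hy hy'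
    rw [Real.norm_of_nonneg (by positivity)]
    have := (norm_sub_le (gradient (A.u k) y) (gradient (A.u i) y)).trans (add_le_add hy hy')
    gcongr
  have hsub : closedBall x δ ∩ Ω ⊆ Ω := Set.inter_subset_right
  have hm : MeasurableSet (closedBall x δ ∩ Ω) := measurableSet_closedBall.inter hΩ.measurableSet
  have hball : volume.real (closedBall x δ ∩ Ω) ≤ δ ^ d * volume.real (ball (0 : E d) 1) := by
    refine (measureReal_mono Set.inter_subset_left measure_closedBall_lt_top.ne).trans_eq ?_
    rw [Measure.addHaar_real_closedBall _ _ hδ0.le, finrank_euclideanSpace_fin]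
  have hcst : IntegrableOn (fun _ : E d => |Λ| ^ p) (closedBall x δ ∩ Ω) :=
    integrableOn_const (measure_ne_top_of_subset hsub hΩb.measure_lt_top.ne)
  have hpt : ∀ᵐ y ∂volume.restrict (closedBall x δ ∩ Ω), ‖gradient (A.u k) y‖ ^ p ≤
      c * (‖gradient (A.u k) y - gradient (A.u i) y‖ ^ p + |Λ| ^ p) := by
    filter_upwards [ae_restrict_of_ae_restrict_of_subset hsub (hB i)] with y hy
    have h1 : ‖gradient (A.u i) y‖ ≤ |Λ| :=
      hy.trans ((hΛ (Set.mem_image_of_mem B hi)).trans (le_abs_self _))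
    have h2 : ‖gradient (A.u k) y‖ ≤
        ‖gradient (A.u k) y - gradient (A.u i) y‖ + |Λ| :=
      (norm_le_norm_sub_add _ _).trans (add_le_add_right h1 _)
    exact (Real.rpow_le_rpow (norm_nonneg _) h2 hp0.le).trans
      (mod_cast NNReal.rpow_add_le_mul_rpow_add_rpow (⟨_, norm_nonneg _⟩ : ℝ≥0)
        ⟨|Λ|, abs_nonneg _⟩ hp.le)
  calc ∫ y in closedBall x δ ∩ Ω, ‖gradient (A.u k) y‖ ^ p
      ≤ ∫ y in closedBall x δ ∩ Ω,
          c * (‖gradient (A.u k) y - gradient (A.u i) y‖ ^ p + |Λ| ^ p) :=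
        integral_mono_ae
          ((integrable_norm_gradient_rpow hΩ hΩb (A.tri k) hp0.le (A.mem k)).mono_set hsub)
          (((hint.mono_set hsub).add hcst).const_mul _) hpt
    _ = c * (∫ y in closedBall x δ ∩ Ω, ‖gradient (A.u k) y - gradient (A.u i) y‖ ^ p) +
          c * (|Λ| ^ p * volume.real (closedBall x δ ∩ Ω)) := by
        rw [integral_const_mul, integral_add (hint.mono_set hsub) hcst, setIntegral_const,
          smul_eq_mul, mul_add, mul_comm (|Λ| ^ p)]
    _ ≤ c * (∫ y in Ω, ‖gradient (A.u k) y - gradient (A.u i) y‖ ^ p) +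
          c * (|Λ| ^ p * (δ ^ d * volume.real (ball (0 : E d) 1))) := by
        have := setIntegral_mono_set hint (ae_of_all _ fun y => by positivity) hsub.eventuallyLE
        gcongr ?_ + ?_
        · exact mul_le_mul_of_nonneg_left this hc0.le
        · gcongr
    _ < ε / 2 + ε / 2 := by
        refine add_lt_add ?_ hδ
        calc _ < c * (ε / (2 * c)) := by gcongr
          _ = ε / 2 := by field_simp
    _ = ε := add_halves ε

end AFEM

/-! ### Geometry of the elements and faces -/

lemma hausdorffMeasure_convexHull_le {n : ℕ} {V : Type*} [NormedAddCommGroup V]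
    [NormedSpace ℝ V] [MeasurableSpace V] [BorelSpace V] (w : Fin (n + 1) → V) :
    μH[n] (convexHull ℝ (Set.range w)) ≤
      ENNReal.ofReal (n * diam (convexHull ℝ (Set.range w))) ^ (n : ℝ) := by
  set F := convexHull ℝ (Set.range w) with hF
  have hb : Bornology.IsBounded F :=
    isBounded_convexHull.2 (Set.finite_range w).isBounded
  have hw : ∀ i, w i ∈ F := fun i => subset_convexHull ℝ _ (Set.mem_range_self i)
  set L : (Fin n → ℝ) →ₗ[ℝ] V := Fintype.linearCombination ℝ fun i => w i.succ - w 0 with hL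
  set f : (Fin n → ℝ) →ᵃ[ℝ] V := L.toAffineMap + AffineMap.const ℝ _ (w 0) with hf
  have hfa : ∀ t, f t = L t + w 0 := fun t => rfl
  have hsub : F ⊆ f '' Set.Icc 0 1 := by
    refine convexHull_min ?_ ((convex_Icc 0 1).affine_image f)
    rintro _ ⟨i, rfl⟩
    refine Fin.cases ⟨0, ⟨le_rfl, zero_le_one⟩, by simp [hfa]⟩ (fun i => ?_) i
    refine ⟨Pi.single i 1, ⟨by simp, fun j => ?_⟩, ?_⟩
    · by_cases hj : j = i
      · subst hj; simp
      · simp [hj]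
    · rw [hfa, hL, Fintype.linearCombination_apply_single]
      simp
  have hlip : LipschitzWith (Real.toNNReal (n * diam F)) f := by
    refine LipschitzWith.of_dist_le_mul fun s t => ?_
    rw [Real.coe_toNNReal _ (by positivity), dist_eq_norm, hfa, hfa, add_sub_add_right_eq_sub,
      ← map_sub, hL, Fintype.linearCombination_apply]
    calc ‖∑ i, (s - t) i • (w i.succ - w 0)‖ ≤ ∑ _i : Fin n, dist s t * diam F := by
          refine norm_sum_le_of_le _ fun i _ => ?_
          rw [norm_smul]
          gcongr
          · rw [dist_eq_norm]; exact norm_le_pi_norm (s - t) i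
          · rw [← dist_eq_norm]; exact dist_le_diam_of_mem hb (hw _) (hw _)
      _ = _ := by simp; ring
  have hvol : μH[n] (Set.Icc (0 : Fin n → ℝ) 1) = 1 := by
    have := hausdorffMeasure_pi_real (ι := Fin n)
    rw [Fintype.card_fin] at this
    rw [this, Real.volume_Icc_pi]
    simp
  calc μH[n] F ≤ μH[n] (f '' Set.Icc 0 1) := measure_mono hsub
    _ ≤ _ := hlip.hausdorffMeasure_image_le n.cast_nonneg _
    _ = _ := by rw [hvol, mul_one]; rfl

lemma IsFaceSimplex.toReal_hausdorffMeasure_le {F : Set (E d)} (hF : IsFaceSimplex d F)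
    (hd : d ≠ 0) : (μH[(d : ℝ) - 1] F).toReal ≤ (d * diam F) ^ ((d : ℝ) - 1) := by
  obtain ⟨n, rfl⟩ := Nat.exists_eq_succ_of_ne_zero hd
  obtain ⟨w, -, rfl⟩ := hF
  have e : ((n.succ : ℕ) : ℝ) - 1 = n := by push_cast; ring
  have h := hausdorffMeasure_convexHull_le w
  rw [e]
  set F := convexHull ℝ (Set.range w)
  refine ENNReal.toReal_le_of_le_ofReal (by positivity) (h.trans ?_)
  rw [ENNReal.ofReal_rpow_of_nonneg (by positivity) n.cast_nonneg]
  gcongr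
  simp

lemma IsFaceSimplex.nonempty {F : Set (E d)} (hF : IsFaceSimplex d F) (hd : d ≠ 0) :
    F.Nonempty := by
  obtain ⟨w, -, rfl⟩ := hF
  exact ⟨w ⟨0, Nat.pos_of_ne_zero hd⟩, subset_convexHull ℝ _ (Set.mem_range_self _)⟩

lemma IsFaceSimplex.faceSize_mul_le {F : Set (E d)} (hF : IsFaceSimplex d F) (hd : 2 ≤ d) :
    faceSize d F * (μH[(d : ℝ) - 1] F).toReal ≤ (d * diam F) ^ d := by
  have hd' : (0 : ℝ) < (d : ℝ) - 1 := by
    have : (2 : ℝ) ≤ d := by exact_mod_cast hd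
    linarith
  have h := hF.toReal_hausdorffMeasure_le (by omega)
  have h1 : faceSize d F ≤ d * diam F := by
    calc faceSize d F ≤ ((d * diam F) ^ ((d : ℝ) - 1)) ^ (1 / ((d : ℝ) - 1)) := by
          unfold faceSize
          gcongr
      _ = d * diam F := by
          rw [← Real.rpow_mul (by positivity), mul_one_div_cancel hd'.ne', Real.rpow_one]
  calc _ ≤ d * diam F * (d * diam F) ^ ((d : ℝ) - 1) := by gcongr
    _ = (d * diam F) ^ d := by
        rw [← Real.rpow_natCast, ← Real.rpow_one_add' (by positivity) (by simp; omega)]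
        ring_nf

lemma rpow_mul_volume_ball_le {K : Set (E d)} (hb : Bornology.IsBounded K) {x : E d} {r : ℝ}
    (hr : 0 < r) (hK : ball x r ⊆ K) :
    r ^ d * volume.real (ball (0 : E d) 1) ≤ volume.real K := by
  have h : volume.real (ball x r) = r ^ d * volume.real (ball (0 : E d) 1) := by
    rw [Measure.real, Measure.addHaar_ball_of_pos volume x hr, ENNReal.toReal_mul,
      finrank_euclideanSpace_fin, ENNReal.toReal_ofReal (by positivity), Measure.real]
  rw [← h]
  exact measureReal_mono hK hb.measure_lt_top.ne

lemma volume_real_ball_pos : 0 < volume.real (ball (0 : E d) 1) :=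
  ENNReal.toReal_pos (measure_ball_pos volume _ one_pos).ne' measure_ball_lt_top.ne

/-- Shape regular elements fill a fixed proportion of every ball centred at one of their
points. -/
lemma pow_mul_volume_ball_le_inter (hd : d ≠ 0) (hγ : 0 < γ) {K : Set (E d)} (hc : Convex ℝ K)
    (hb : Bornology.IsBounded K) {x : E d} {r : ℝ} (hr : 0 < r) (hK : ball x r ⊆ K)
    (hdiam : diam K ≤ γ * r) {y : E d} (hy : y ∈ K) {D : ℝ} (hD : 0 ≤ D) (hDK : D ≤ diam K) :
    D ^ d * volume.real (ball (0 : E d) 1) ≤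
      γ ^ d * volume.real (K ∩ closedBall y D) := by
  rcases hD.eq_or_lt with rfl | hD0
  · simp only [zero_pow hd, zero_mul]; positivity
  have hK0 : 0 < diam K := hD0.trans_le hDK
  set t := D / diam K with ht
  have ht0 : 0 ≤ t := by positivity
  have ht1 : t ≤ 1 := (div_le_one hK0).2 hDK
  have hsub : AffineMap.homothety y t '' K ⊆ K ∩ closedBall y D := by
    rintro _ ⟨w, hw, rfl⟩
    constructor
    · rw [AffineMap.homothety_eq_lineMap]
      exact hc.lineMap_mem hy hw ⟨ht0, ht1⟩
    · rw [mem_closedBall, dist_homothety_center, Real.norm_of_nonneg ht0]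
      calc t * dist y w ≤ t * diam K := by gcongr; exact dist_le_diam_of_mem hb hy hw
        _ = D := div_mul_cancel₀ _ hK0.ne'
  have h1 : t ^ d * volume.real K ≤ volume.real (K ∩ closedBall y D) := by
    refine le_trans (le_of_eq ?_) (measureReal_mono hsub
      (hb.subset Set.inter_subset_left).measure_lt_top.ne)
    rw [Measure.real, Measure.real, Measure.addHaar_image_homothety, ENNReal.toReal_mul,
      finrank_euclideanSpace_fin, ENNReal.toReal_ofReal (abs_nonneg _),
      abs_of_nonneg (by positivity)]
  have h2 := rpow_mul_volume_ball_le hb hr hK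
  have h3 : D ≤ γ * (t * r) := by
    rw [ht]
    calc D = D / diam K * diam K := (div_mul_cancel₀ _ hK0.ne').symm
      _ ≤ D / diam K * (γ * r) := by gcongr
      _ = _ := by ring
  calc D ^ d * volume.real (ball (0 : E d) 1)
      ≤ (γ * (t * r)) ^ d * volume.real (ball (0 : E d) 1) := by gcongr
    _ = γ ^ d * (t ^ d * (r ^ d * volume.real (ball (0 : E d) 1))) := by ring
    _ ≤ γ ^ d * (t ^ d * volume.real K) := by gcongr
    _ ≤ _ := by gcongr

lemma diam_le_mul_meshSize (hd : d ≠ 0) (hγ : 0 < γ) {K : Set (E d)}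
    (hb : Bornology.IsBounded K) {x : E d} {r : ℝ} (hr : 0 < r) (hK : ball x r ⊆ K)
    (hdiam : diam K ≤ γ * r) :
    diam K ≤ γ / volume.real (ball (0 : E d) 1) ^ ((1 : ℝ) / d) * meshSize d K := by
  have hω := volume_real_ball_pos (d := d)
  have h : r * volume.real (ball (0 : E d) 1) ^ ((1 : ℝ) / d) ≤ meshSize d K := by
    have := Real.rpow_le_rpow (by positivity) (rpow_mul_volume_ball_le hb hr hK)
      (by positivity : (0 : ℝ) ≤ 1 / d)
    rwa [Real.mul_rpow (by positivity) (by positivity), one_div,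
      Real.pow_rpow_inv_natCast hr.le hd, ← one_div] at this
  calc diam K ≤ γ * r := hdiam
    _ = γ / volume.real (ball (0 : E d) 1) ^ ((1 : ℝ) / d) *
        (r * volume.real (ball (0 : E d) 1) ^ ((1 : ℝ) / d)) := by field_simp
    _ ≤ _ := by gcongr

lemma norm_flux (hp : 1 < p) (a : E d) : ‖flux d p a‖ = ‖a‖ ^ (p - 1) := by
  rw [flux, norm_smul, Real.norm_of_nonneg (by positivity)]
  rcases eq_or_ne a 0 with rfl | ha
  · simp [Real.zero_rpow (by linarith : p - 1 ≠ 0)]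
  · rw [← Real.rpow_add_one (norm_ne_zero_iff.2 ha)]
    ring_nf

lemma norm_flux_sub_rpow_le (hp : 1 < p) (a b : E d) :
    ‖flux d p a - flux d p b‖ ^ (p / (p - 1)) ≤
      2 ^ (p / (p - 1)) * (‖a‖ ^ p + ‖b‖ ^ p) := by
  have hp1 : 0 < p - 1 := by linarith
  have hq : 0 ≤ p / (p - 1) := by positivity
  have key : ∀ c : ℝ, 0 ≤ c → (2 * c ^ (p - 1)) ^ (p / (p - 1)) = 2 ^ (p / (p - 1)) * c ^ p :=
    fun c hc => by
      rw [Real.mul_rpow (by norm_num) (by positivity), ← Real.rpow_mul hc,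
        mul_div_cancel₀ _ hp1.ne']
  have h : ‖flux d p a - flux d p b‖ ≤ 2 * max ‖a‖ ‖b‖ ^ (p - 1) := by
    refine (norm_sub_le _ _).trans ?_
    rw [norm_flux hp, norm_flux hp, two_mul]
    gcongr
    · exact le_max_left _ _
    · exact le_max_right _ _
  refine (Real.rpow_le_rpow (norm_nonneg _) h hq).trans ?_
  rw [key _ (by positivity)]
  gcongr
  have ha : 0 ≤ ‖a‖ ^ p := by positivity
  have hb : 0 ≤ ‖b‖ ^ p := by positivity
  rcases max_choice ‖a‖ ‖b‖ with h | h <;> rw [h] <;> linarith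

/-! ### Bound of the local indicator -/

lemma sum_volume_inter_le {T : Finset (Set (E d))} (hT : IsTriangulation d Ω T) {B : Set (E d)}
    (hB : MeasurableSet B) (hBt : volume B ≠ ∞) :
    ∑ K ∈ T, volume.real (K ∩ B) ≤ volume.real B := by
  have hm : ∀ K ∈ T, MeasurableSet K := fun K hK => (hT.1 K hK).isCompact.isClosed.measurableSet
  have hfr : ∀ᵐ y : E d, ∀ K ∈ T, y ∈ K → y ∈ interior K := by
    filter_upwards [ae_notMem_frontier hT] with y hy K hK hyK
    have h := hy K hK
    rw [frontier, (hT.1 K hK).isCompact.isClosed.closure_eq] at h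
    by_contra h'
    exact h ⟨hyK, h'⟩
  have hdisj : (T : Set (Set (E d))).Pairwise (Function.onFun (AEDisjoint volume) (· ∩ B)) := by
    intro K hK K' hK' hne
    refine measure_eq_zero_iff_ae_notMem.2 ?_
    filter_upwards [hfr] with y hy ⟨h1, h2⟩
    have : y ∈ interior K ∩ interior K' := ⟨hy K hK h1.1, hy K' hK' h2.1⟩
    rw [hT.2.2 K hK K' hK' hne] at this
    exact this
  have h := measure_biUnion_finset₀ hdisj fun K hK => ((hm K hK).inter hB).nullMeasurableSet
  simp only [Measure.real]
  rw [← ENNReal.toReal_sum fun K _ => measure_ne_top_of_subset Set.inter_subset_right hBt, ← h]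
  exact ENNReal.toReal_mono hBt (measure_mono (Set.iUnion₂_subset
    fun K _ => Set.inter_subset_right))

lemma sum_volume_mul_le_integral (hΩ : IsOpen Ω) (hp : 0 < p) {T T' : Finset (Set (E d))}
    (hT : IsTriangulation d Ω T) {v : E d → ℝ} (hv : ∀ x ∉ Ω, v x = 0) {g : Set (E d) → E d}
    (hg : ∀ K ∈ T, ∃ c : ℝ, ∀ x ∈ K, v x = ⟪g K, x⟫ + c) (hT' : T' ⊆ T) {B : Set (E d)}
    (hB : MeasurableSet B) (hBK : ∀ K ∈ T', K ⊆ B) :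
    ∑ K ∈ T', volume.real K * ‖g K‖ ^ p ≤ ∫ x in B ∩ Ω, ‖gradient v x‖ ^ p := by
  have hm : ∀ K ∈ T, MeasurableSet K := fun K hK => (hT.1 K hK).isCompact.isClosed.measurableSet
  have hKt : ∀ K ∈ T, volume K ≠ ∞ := fun K hK => (hT.1 K hK).isCompact.measure_lt_top.ne
  have h := setIntegral_congr_ae (μ := volume) hB <|
    (ae_sum_indicator_eq hT hv hg (φ := fun z => ‖z‖ ^ p)
      (by simp [Real.zero_rpow hp.ne'])).mono fun y hy _ => hy
  have hint : ∀ K ∈ T, IntegrableOn (K.indicator fun _ => ‖g K‖ ^ p) B := fun K hK =>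
    ((integrable_indicator_iff (hm K hK)).2 (integrableOn_const (hKt K hK))).integrableOn
  rw [setIntegral_indicator hΩ.measurableSet, integral_finsetSum _ hint] at h
  rw [← h]
  calc ∑ K ∈ T', volume.real K * ‖g K‖ ^ p
      = ∑ K ∈ T', volume.real (B ∩ K) * ‖g K‖ ^ p :=
        Finset.sum_congr rfl fun K hK => by rw [Set.inter_eq_right.2 (hBK K hK)]
    _ ≤ ∑ K ∈ T, volume.real (B ∩ K) * ‖g K‖ ^ p :=
        Finset.sum_le_sum_of_subset_of_nonneg hT' fun K _ _ => by positivity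
    _ = _ := Finset.sum_congr rfl fun K hK => by
        rw [setIntegral_indicator (hm K hK), setIntegral_const, smul_eq_mul]

lemma etaQLoc_nonneg {T : Finset (Set (E d))} {g : Set (E d) → E d} {μ : ℝ} {u : E d → ℝ}
    {K : Set (E d)} : 0 ≤ etaQLoc d Ω p T g μ u K := by
  refine add_nonneg (mul_nonneg (by unfold meshSize; positivity)
    (integral_nonneg fun _ => by positivity)) (Finset.sum_nonneg fun K' _ => ?_)
  split_ifs
  · exact mul_nonneg (by unfold faceSize; positivity) (integral_nonneg fun _ => by positivity)
  · exact le_rfl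

/-- The jump terms are controlled by the gradient on a neighbourhood of the element. -/
lemma sum_jump_le (hd : 2 ≤ d) (hΩ : IsOpen Ω) (hp : 1 < p) (hγ : 0 < γ)
    {T : Finset (Set (E d))} (hT : IsTriangulation d Ω T)
    (hshape : ∀ K ∈ T, ∃ x r, 0 < r ∧ ball x r ⊆ K ∧ diam K ≤ γ * r)
    {v : E d → ℝ} (hv : ∀ x ∉ Ω, v x = 0) {g : Set (E d) → E d}
    (hg : ∀ K ∈ T, ∃ c : ℝ, ∀ x ∈ K, v x = ⟪g K, x⟫ + c) {K : Set (E d)} (hK : K ∈ T)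
    {B : Set (E d)} (hB : MeasurableSet B) (hBK : ∀ K' ∈ T, (K ∩ K').Nonempty → K' ⊆ B) :
    (∑ K' ∈ T, if K' ≠ K ∧ IsInteriorFace d Ω (K ∩ K') then
      faceSize d (K ∩ K') * ∫ x in K ∩ K',
        ‖flux d p (g K) - flux d p (g K')‖ ^ (p / (p - 1)) ∂ μH[(d : ℝ) - 1]
      else 0) ≤
    d ^ d * 2 ^ (p / (p - 1)) * (γ ^ d * ((2 * γ) ^ d + 1) / volume.real (ball (0 : E d) 1)) *
      ∫ x in B ∩ Ω, ‖gradient v x‖ ^ p := by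
  have hd0 : d ≠ 0 := by omega
  set ω := volume.real (ball (0 : E d) 1) with hω
  have hω0 : 0 < ω := volume_real_ball_pos
  set I := ∫ x in B ∩ Ω, ‖gradient v x‖ ^ p with hI
  set q := p / (p - 1)
  rw [← Finset.sum_filter]
  set T' := T.filter fun K' => K' ≠ K ∧ IsInteriorFace d Ω (K ∩ K') with hT'
  have hT'T : T' ⊆ T := Finset.filter_subset _ _
  have hface : ∀ K' ∈ T', IsFaceSimplex d (K ∩ K') := fun K' hK' =>
    (Finset.mem_filter.1 hK').2.2.1
  have hne : ∀ K' ∈ T', (K ∩ K').Nonempty := fun K' hK' => (hface K' hK').nonempty hd0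
  have hKb : ∀ K ∈ T, Bornology.IsBounded K := fun K hK => (hT.1 K hK).isCompact.isBounded
  have hfat : ∀ K' ∈ T, ∀ y ∈ K', ∀ D, 0 ≤ D → D ≤ diam K' →
      D ^ d * ω ≤ γ ^ d * volume.real (K' ∩ closedBall y D) := by
    intro K' hK' y hy D hD hDK
    obtain ⟨x, r, hr, hx, hxr⟩ := hshape K' hK'
    exact pow_mul_volume_ball_le_inter hd0 hγ (hT.1 K' hK').convex (hKb K' hK') hr hx hxr hy hD hDK
  have hfat' : ∀ K' ∈ T, ∀ D, 0 ≤ D → D ≤ diam K' → D ^ d * ω ≤ γ ^ d * volume.real K' := by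
    intro K' hK' D hD hDK
    obtain ⟨y, hy⟩ := (hT.1 K' hK').nonempty
    refine (hfat K' hK' y hy D hD hDK).trans ?_
    gcongr
    · exact (hKb K' hK').measure_lt_top.ne
    · exact Set.inter_subset_left
  have hDK : ∀ K' ∈ T', diam (K ∩ K') ≤ diam K := fun K' _ =>
    diam_mono Set.inter_subset_left (hKb K hK)
  have hDK' : ∀ K' ∈ T', diam (K ∩ K') ≤ diam K' := fun K' hK' =>
    diam_mono Set.inter_subset_right (hKb K' (hT'T hK'))
  obtain ⟨x₀, hx₀⟩ := (hT.1 K hK).nonempty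
  have hpack : ∑ K' ∈ T', diam (K ∩ K') ^ d ≤ (2 * γ) ^ d * diam K ^ d := by
    refine le_of_mul_le_mul_right ?_ hω0
    calc (∑ K' ∈ T', diam (K ∩ K') ^ d) * ω
        = ∑ K' ∈ T', diam (K ∩ K') ^ d * ω := Finset.sum_mul _ _ _
      _ ≤ ∑ K' ∈ T', γ ^ d * volume.real (K' ∩ closedBall x₀ (2 * diam K)) := by
          refine Finset.sum_le_sum fun K' hK' => ?_
          obtain ⟨y, hyK, hyK'⟩ := hne K' hK'
          refine (hfat K' (hT'T hK') y hyK' _ diam_nonneg (hDK' K' hK')).trans ?_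
          gcongr
          · exact measure_ne_top_of_subset Set.inter_subset_left
              (hKb K' (hT'T hK')).measure_lt_top.ne
          · refine closedBall_subset_closedBall' ?_
            have := dist_le_diam_of_mem (hKb K hK) hyK hx₀
            have := hDK K' hK'
            linarith
      _ ≤ ∑ K' ∈ T, γ ^ d * volume.real (K' ∩ closedBall x₀ (2 * diam K)) :=
          Finset.sum_le_sum_of_subset_of_nonneg hT'T fun _ _ _ => by positivity
      _ ≤ γ ^ d * volume.real (closedBall x₀ (2 * diam K)) := by
          rw [← Finset.mul_sum]
          gcongr
          exact sum_volume_inter_le hT measurableSet_closedBall measure_closedBall_lt_top.ne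
      _ = (2 * γ) ^ d * diam K ^ d * ω := by
          rw [Measure.addHaar_real_closedBall _ _ (by positivity), finrank_euclideanSpace_fin]
          ring
  have hIK : volume.real K * ‖g K‖ ^ p ≤ I := by
    simpa using sum_volume_mul_le_integral (T' := {K}) hΩ (by linarith) hT hv hg (by simpa) hB
      (by simpa using hBK K hK (by simpa using ⟨x₀, hx₀⟩))
  have hIT' : ∑ K' ∈ T', volume.real K' * ‖g K'‖ ^ p ≤ I :=
    sum_volume_mul_le_integral hΩ (by linarith) hT hv hg hT'T hB
      fun K' hK' => hBK K' (hT'T hK') (hne K' hK')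
  have h1 : (∑ K' ∈ T', diam (K ∩ K') ^ d) * ‖g K‖ ^ p ≤ (2 * γ) ^ d * (γ ^ d / ω * I) := by
    calc _ ≤ (2 * γ) ^ d * diam K ^ d * ‖g K‖ ^ p := by gcongr
      _ ≤ (2 * γ) ^ d * (γ ^ d / ω * volume.real K) * ‖g K‖ ^ p := by
          gcongr
          rw [div_mul_eq_mul_div, le_div_iff₀ hω0]
          exact hfat' K hK _ diam_nonneg le_rfl
      _ = (2 * γ) ^ d * (γ ^ d / ω * (volume.real K * ‖g K‖ ^ p)) := by ring
      _ ≤ _ := by gcongr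
  have h2 : ∑ K' ∈ T', diam (K ∩ K') ^ d * ‖g K'‖ ^ p ≤ γ ^ d / ω * I := by
    calc _ ≤ ∑ K' ∈ T', γ ^ d / ω * (volume.real K' * ‖g K'‖ ^ p) := by
          refine Finset.sum_le_sum fun K' hK' => ?_
          rw [← mul_assoc]
          gcongr
          rw [div_mul_eq_mul_div, le_div_iff₀ hω0]
          exact hfat' K' (hT'T hK') _ diam_nonneg (hDK' K' hK')
      _ ≤ _ := by
          rw [← Finset.mul_sum]
          gcongr
  calc _ ≤ ∑ K' ∈ T', (d * diam (K ∩ K')) ^ d * (2 ^ q * (‖g K‖ ^ p + ‖g K'‖ ^ p)) := by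
        refine Finset.sum_le_sum fun K' hK' => ?_
        rw [setIntegral_const, smul_eq_mul, ← mul_assoc]
        exact mul_le_mul ((hface K' hK').faceSize_mul_le hd) (norm_flux_sub_rpow_le hp _ _)
          (by positivity) (by positivity)
    _ = d ^ d * 2 ^ q * ((∑ K' ∈ T', diam (K ∩ K') ^ d) * ‖g K‖ ^ p +
          ∑ K' ∈ T', diam (K ∩ K') ^ d * ‖g K'‖ ^ p) := by
        rw [Finset.sum_mul, ← Finset.sum_add_distrib, Finset.mul_sum]
        exact Finset.sum_congr rfl fun K' _ => by ring
    _ ≤ d ^ d * 2 ^ q * ((2 * γ) ^ d * (γ ^ d / ω * I) + γ ^ d / ω * I) := by gcongr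
    _ = _ := by ring

lemma setIntegral_residual_le (hp : 1 < p) {v : E d → ℝ} (hv : Continuous v)
    (hvc : HasCompactSupport v) (hv0 : ∀ x ∉ Ω, v x = 0) (h1 : lpPow d Ω p v = 1) {μ : ℝ}
    (hμ : 0 ≤ μ) (K : Set (E d)) :
    ∫ x in K, |μ * |v x| ^ (p - 2) * v x| ^ (p / (p - 1)) ≤ μ ^ (p / (p - 1)) := by
  have hp0 : 0 < p := by linarith
  have hp1 : 0 < p - 1 := by linarith
  have e : ∀ x, |μ * |v x| ^ (p - 2) * v x| ^ (p / (p - 1)) =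
      μ ^ (p / (p - 1)) * |v x| ^ p := by
    intro x
    have e1 : |μ * |v x| ^ (p - 2) * v x| = μ * |v x| ^ (p - 1) := by
      rw [abs_mul, abs_of_nonneg (by positivity : 0 ≤ μ * |v x| ^ (p - 2)), mul_assoc]
      congr 1
      rcases eq_or_ne (v x) 0 with h | h
      · simp [h, Real.zero_rpow hp1.ne']
      · rw [← Real.rpow_add_one (abs_ne_zero.2 h)]
        ring_nf
    rw [e1, Real.mul_rpow hμ (by positivity), ← Real.rpow_mul (abs_nonneg _),
      mul_div_cancel₀ _ hp1.ne']
  simp only [e]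
  rw [integral_const_mul]
  refine mul_le_of_le_one_right (by positivity) ?_
  calc ∫ x in K, |v x| ^ p ≤ ∫ x, |v x| ^ p :=
        setIntegral_le_integral (integrableOn_abs_rpow hp0 hv hvc)
          (ae_of_all _ fun z => by positivity)
    _ = 1 := by
        rw [← h1, lpPow]
        refine (setIntegral_eq_integral_of_forall_compl_eq_zero fun x hx => ?_).symm
        simp [hv0 x hx, Real.zero_rpow hp0.ne']

namespace AFEM

variable (A : AFEM d Ω p γ)

lemma meshSizeSupOn_nonneg (k : ℕ) (S : Set (E d)) : 0 ≤ meshSizeSupOn A k S := by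
  refine Real.sSup_nonneg ?_
  rintro _ ⟨K, -, rfl⟩
  unfold meshSize
  positivity

/-- All elements touching a marked element belong to the refined region. -/
lemma meshSize_le_of_inter_nonempty {k : ℕ} {K K' : Set (E d)} (hK : K ∈ A.M k)
    (hK' : K' ∈ A.T k) (h : (K ∩ K').Nonempty) :
    meshSize d K' ≤ meshSizeSupOn A k (Omega0 A k) := by
  refine le_csSup (((A.T k).finite_toSet.subset fun _ h => h.1).image _).bddAbove
    ⟨K', ⟨hK', ?_⟩, rfl⟩
  obtain ⟨z, hz⟩ := h
  refine ⟨z, hz.2, ?_⟩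
  simp only [Omega0, Set.mem_iUnion]
  refine ⟨K, ⟨A.marked k hK, k + 1, k.le_succ, A.refined k K hK⟩, ?_⟩
  simp only [patch, Set.mem_iUnion]
  exact ⟨K', hK', ⟨z, hz⟩, hz.2⟩

lemma exists_etaQLoc_lt (hd : 2 ≤ d) (hΩ : IsOpen Ω) (hΩb : Bornology.IsBounded Ω) (hp : 1 < p)
    (hγ : 0 < γ) (hmesh : Tendsto (fun k => meshSizeSupOn A k (Omega0 A k)) atTop (𝓝 0))
    {ε : ℝ} (hε : 0 < ε) :
    ∃ N, ∀ k ≥ N, ∀ K ∈ A.M k, etaQLoc d Ω p (A.T k) (A.g k) (A.μ k) (A.u k) K < ε := by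
  have hp0 : 0 < p := by linarith
  have hp1 : 0 < p - 1 := by linarith
  have hd0 : d ≠ 0 := by omega
  set q := p / (p - 1) with hq
  have hq0 : 0 < q := by positivity
  set ω := volume.real (ball (0 : E d) 1) with hω
  have hω0 : 0 < ω := volume_real_ball_pos
  set C : ℝ := d ^ d * 2 ^ q * (γ ^ d * ((2 * γ) ^ d + 1) / ω) with hC
  have hC0 : 0 < C := by
    have : (0 : ℝ) < d := by exact_mod_cast Nat.pos_of_ne_zero hd0
    positivity
  set c := γ / ω ^ ((1 : ℝ) / d) with hc
  have hc0 : 0 < c := by positivity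
  obtain ⟨δ, hδ, N, hN⟩ := A.exists_integral_closedBall_lt hd0 hΩ hΩb hp
    (ε := ε / (2 * C)) (by positivity)
  have hlim1 : Tendsto (fun k => 2 * (c * meshSizeSupOn A k (Omega0 A k))) atTop (𝓝 0) := by
    simpa using (hmesh.const_mul c).const_mul 2
  have hlim2 : Tendsto (fun k => meshSizeSupOn A k (Omega0 A k) ^ q * A.μ 0 ^ q) atTop (𝓝 0) := by
    simpa [Real.zero_rpow hq0.ne'] using
      (hmesh.rpow_const (Or.inr hq0.le)).mul_const (A.μ 0 ^ q)
  obtain ⟨N', hN'⟩ := eventually_atTop.1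
    ((hlim1.eventually_lt_const hδ).and (hlim2.eventually_lt_const (half_pos hε)))
  refine ⟨max N N', fun k hk K hK => ?_⟩
  obtain ⟨hk1, hk2⟩ := hN' k (le_of_max_le_right hk)
  have hT := A.tri k
  have hKT := A.marked k hK
  set m := meshSizeSupOn A k (Omega0 A k) with hm
  have hm0 : 0 ≤ m := A.meshSizeSupOn_nonneg k _
  have hu := (A.mem k).2.1
  have hdiam : ∀ K' ∈ A.T k, (K ∩ K').Nonempty → diam K' ≤ c * m := by
    intro K' hK' hne
    obtain ⟨x, r, hr, hx, hxr⟩ := A.shape k K' hK'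
    refine (diam_le_mul_meshSize hd0 hγ (hT.1 K' hK').isCompact.isBounded hr hx hxr).trans ?_
    exact mul_le_mul_of_nonneg_left (A.meshSize_le_of_inter_nonempty hK hK' hne) hc0.le
  obtain ⟨x₀, hx₀⟩ := (hT.1 K hKT).nonempty
  have hKK : (K ∩ K).Nonempty := by simpa using ⟨x₀, hx₀⟩
  have hsub : ∀ K' ∈ A.T k, (K ∩ K').Nonempty → K' ⊆ closedBall x₀ δ := by
    intro K' hK' hne z hz
    obtain ⟨y, hy, hy'⟩ := hne
    have h1 := (dist_le_diam_of_mem (hT.1 K' hK').isCompact.isBounded hz hy').trans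
      (hdiam K' hK' ⟨y, hy, hy'⟩)
    have h2 := (dist_le_diam_of_mem (hT.1 K hKT).isCompact.isBounded hy hx₀).trans
      (hdiam K hKT hKK)
    rw [mem_closedBall]
    linarith [dist_triangle z y x₀]
  have hjump := sum_jump_le hd hΩ hp hγ hT (A.shape k) hu (A.gradComp k) hKT
    measurableSet_closedBall hsub
  have hvol : meshSize d K ^ q *
      (∫ x in K, |A.μ k * |A.u k x| ^ (p - 2) * A.u k x| ^ q) ≤ m ^ q * A.μ 0 ^ q := by
    have h1 : 0 ≤ meshSize d K := by unfold meshSize; positivity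
    have h2 := A.μ_nonneg k
    refine mul_le_mul ?_ ((setIntegral_residual_le hp (A.continuous_u hΩ k)
      (A.hasCompactSupport_u hΩb k) hu (A.normed k) h2 K).trans ?_)
      (integral_nonneg fun x => by positivity) (by positivity)
    · exact Real.rpow_le_rpow h1 (A.meshSize_le_of_inter_nonempty hK hKT hKK) hq0.le
    · exact Real.rpow_le_rpow h2 (A.antitone_μ hp0 k.zero_le) hq0.le
  have hI := hN k (le_of_max_le_left hk) x₀
  calc etaQLoc d Ω p (A.T k) (A.g k) (A.μ k) (A.u k) K
      ≤ m ^ q * A.μ 0 ^ q + C * ∫ x in closedBall x₀ δ ∩ Ω, ‖gradient (A.u k) x‖ ^ p :=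
        add_le_add hvol hjump
    _ < ε / 2 + C * (ε / (2 * C)) := by gcongr
    _ = ε := by field_simp; ring

end AFEM

/-- Along a subsequence with ‖u_{k_j} − u_∞‖_{W^{1,p}(Ω)} → 0, the
largest marked local error indicator vanishes:
lim_j max_{K ∈ M_{k_j}} η_{k_j}(μ_{k_j}, u_{k_j}; K) = 0. The hypothesis `hmesh` encodes
the mesh-size property ‖h_k χ_k^0‖_{L^∞(Ω)} → 0 of bisection. -/
theorem marked_indicator_vanishes
    (d : ℕ) (hd : d = 2 ∨ d = 3) (Ω : Set (E d)) (hΩo : IsOpen Ω)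
    (hΩb : Bornology.IsBounded Ω) (hΩc : IsConnected Ω)
    (p : ℝ) (hp : 1 < p) (γ : ℝ) (hγ : 0 < γ)
    (A : AFEM d Ω p γ)
    (hmesh : Tendsto (fun k => meshSizeSupOn A k (Omega0 A k)) atTop (nhds 0))
    (uinf : E d → ℝ) (huinf : uinf ∈ Vinf A)
    (hnorm : lpPow d Ω p uinf = 1)
    (hmin : ∀ v ∈ Vinf A, lpPow d Ω p v ≠ 0 →
      rayleigh d Ω p uinf ≤ rayleigh d Ω p v)
    (kk : ℕ → ℕ) (hkk : StrictMono kk)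
    (hconv : Tendsto (fun j => w1pDist d Ω p (A.u (kk j)) uinf) atTop (nhds 0)) :
    Tendsto (fun j => (A.M (kk j)).sup' (A.markedNe (kk j))
        (fun K => etaQLoc d Ω p (A.T (kk j)) (A.g (kk j)) (A.μ (kk j)) (A.u (kk j)) K
          ^ ((p - 1) / p)))
      atTop (nhds 0) := by
  have hp0 : 0 < p := by linarith
  have hp1 : 0 < p - 1 := by linarith
  refine Metric.tendsto_atTop.2 fun ε hε => ?_
  obtain ⟨N, hN⟩ := A.exists_etaQLoc_lt (by omega) hΩo hΩb hp hγ hmesh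
    (ε := ε ^ (p / (p - 1))) (by positivity)
  refine ⟨N, fun j hj => ?_⟩
  rw [Real.dist_0_eq_abs, abs_of_nonneg]
  · refine (Finset.sup'_lt_iff _).2 fun K hK => ?_
    have h := Real.rpow_lt_rpow etaQLoc_nonneg (hN (kk j) (hj.trans (hkk.id_le j)) K hK)
      (by positivity : 0 < (p - 1) / p)
    rwa [← Real.rpow_mul hε.le, show p / (p - 1) * ((p - 1) / p) = 1 by field_simp,
      Real.rpow_one] at h
  · obtain ⟨K₀, hK₀⟩ := id (A.markedNe (kk j))
    exact (Real.rpow_nonneg etaQLoc_nonneg _).trans (Finset.le_sup' (fun K =>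
      etaQLoc d Ω p (A.T (kk j)) (A.g (kk j)) (A.μ (kk j)) (A.u (kk j)) K ^ ((p - 1) / p)) hK₀)

end PLaplacianAFEM
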